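/- arXiv:1710.05347 — 2 statements merged into one kernel-verified Lean document; each statement's English description precedes it below -/
import Mathlib

section
/- Let k ≥ 1 and r ≥ 2 be integers, n ≥ kr(k+r−2) + 2r − 1, and let H be the r-uniform hypergraph consisting of exactly k pairwise disjoint edges. An r-graph G on n vertices satisfies φ_H^r(G) = φ_H^r(n) if and only if either G is obtained from the complete r-graph K_n^r by deleting exactly ℓ edges, where ℓ is the unique integer with 0 ≤ ℓ ≤ k−1 and C(n,r) − ℓ ≡ k−1 (mod k), or G = K_n^r and C(n,r) ≡ k−2 (mod k). -/
/-- `p` is a copy of the `r`-graph `H` consisting of exactly `k` pairwise disjoint edges: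
a set of `k` pairwise disjoint edges. -/
def IsMatchingSet (k : ℕ) {n : ℕ} (p : Finset (Finset (Fin n))) : Prop :=
  p.card = k ∧ ∀ e ∈ p, ∀ f ∈ p, e ≠ f → Disjoint e f

/-- A decomposition of the edge set `G` of an `r`-graph into parts `P`, where each part is
either a single edge or a copy of the `r`-graph `H` consisting of `k` pairwise disjoint
edges. -/
def IsMatchingDecomp (k : ℕ) {n : ℕ} (G : Finset (Finset (Fin n)))
    (P : Finset (Finset (Finset (Fin n)))) : Prop :=
  (∀ p ∈ P, ∀ q ∈ P, p ≠ q → Disjoint p q) ∧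
    P.biUnion id = G ∧
    ∀ p ∈ P, (∃ e, p = {e}) ∨ IsMatchingSet k p

/-- `φ_H^r(G)`: the minimum number of parts in an `H`-decomposition of `G`, where `H`
consists of `k` pairwise disjoint edges. -/
noncomputable def phiM (k : ℕ) {n : ℕ} (G : Finset (Finset (Fin n))) : ℕ :=
  sInf {m | ∃ P, IsMatchingDecomp k G P ∧ P.card = m}

/-- `φ_H^r(n)`: the maximum of `φ_H^r(G)` over all `r`-graphs `G` on `n` vertices. -/
noncomputable def phiMMax (r k n : ℕ) : ℕ :=
  sSup {m | ∃ G : Finset (Finset (Fin n)), (∀ e ∈ G, e.card = r) ∧ phiM k G = m}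

section EquitableColouring

open scoped Classical
open Relation

variable {V ι : Type*}

/-- `c` is a proper colouring, with colours from `C`, of the vertices in `S`. -/
structure IsColouring (adj : V → V → Prop) (S : Finset V) (C : Finset ι) (c : V → ι) : Prop where
  mem : ∀ x ∈ S, c x ∈ C
  ne : ∀ x ∈ S, ∀ y ∈ S, adj x y → c x ≠ c y

/-- Some vertex of colour `a` can be recoloured with `b`. -/
def Movable (adj : V → V → Prop) (S : Finset V) (C : Finset ι) (c : V → ι) (a b : ι) : Prop :=
  a ∈ C ∧ b ∈ C ∧ a ≠ b ∧ ∃ x ∈ S, c x = a ∧ ∀ y ∈ S, c y = b → ¬ adj x y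

lemma reflTransGen_avoid_start {E : ι → ι → Prop} {i j : ι} (h : ReflTransGen E i j) :
    ReflTransGen (fun a b => E a b ∧ b ≠ i) i j := by
  induction h with
  | refl => exact .refl
  | @tail b c _ hbc ih =>
    by_cases hc : c = i
    · rw [hc]
    · exact ih.tail ⟨hbc, hc⟩

lemma card_filter_update {S : Finset V} (c : V → ι) {x : V} (hx : x ∈ S) (w l : ι) :
    (S.filter fun y => Function.update c x w y = l).card + (if l = c x then 1 else 0) =
      (S.filter fun y => c y = l).card + (if l = w then 1 else 0) := by
  rw [Finset.card_filter, Finset.card_filter, ← Finset.add_sum_erase _ _ hx,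
    ← Finset.add_sum_erase _ (fun y => if c y = l then 1 else 0) hx]
  have : ∑ y ∈ S.erase x, (if Function.update c x w y = l then 1 else 0) =
      ∑ y ∈ S.erase x, (if c y = l then 1 else 0) := by
    refine Finset.sum_congr rfl fun y hy => ?_
    rw [Function.update_of_ne (Finset.ne_of_mem_erase hy)]
  rw [this, Function.update_self]
  simp only [eq_comm (a := l)]
  ring

lemma IsColouring.update {adj : V → V → Prop} (hs : ∀ x y, adj x y → adj y x)
    {S : Finset V} {C : Finset ι} {c : V → ι} (hc : IsColouring adj S C c) {x : V} {w : ι}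
    (hw : w ∈ C) (hx : x ∈ S) (hxw : ∀ y ∈ S, c y = w → ¬ adj x y) :
    IsColouring adj S C (Function.update c x w) := by
  constructor
  · intro y hy
    by_cases h : y = x
    · subst h; simpa using hw
    · rw [Function.update_of_ne h]; exact hc.mem y hy
  · intro y hy z hz hyz
    by_cases h : y = x
    · subst h
      by_cases h' : z = y
      · subst h'; exact absurd rfl (hc.ne z hx z hx hyz)
      · rw [Function.update_self, Function.update_of_ne h']
        exact fun e => hxw z hz e.symm hyz
    · by_cases h' : z = x
      · subst h'
        rw [Function.update_self, Function.update_of_ne h]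
        exact fun e => hxw y hy e (hs _ _ hyz)
      · rw [Function.update_of_ne h, Function.update_of_ne h']; exact hc.ne y hy z hz hyz

lemma exists_shift {adj : V → V → Prop} (hs : ∀ x y, adj x y → adj y x) {S : Finset V}
    {C : Finset ι} {v : ι} (T : Finset ι) : ∀ (c : V → ι) (i : ι), IsColouring adj S C c → i ∉ T →
      ReflTransGen (fun a b => Movable adj S C c a b ∧ b ∈ T) i v →
      ∃ c' : V → ι, IsColouring adj S C c' ∧ ∀ l,
        (S.filter fun y => c' y = l).card + (if l = i then 1 else 0) =
        (S.filter fun y => c y = l).card + (if l = v then 1 else 0) := by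
  induction T using Finset.strongInduction with
  | H T ih =>
    intro c i hc hi h
    rcases h.cases_head with rfl | ⟨i', ⟨⟨_, hi'C, _, x, hxS, hxi, hx⟩, hi'T⟩, hrest⟩
    · exact ⟨c, hc, fun _ => rfl⟩
    have hc1 := hc.update hs hi'C hxS hx
    have key : ∀ k, ReflTransGen (fun a b => (Movable adj S C c a b ∧ b ∈ T) ∧ b ≠ i') k v →
        k ≠ i → ReflTransGen (fun a b => Movable adj S C (Function.update c x i') a b ∧
          b ∈ T.erase i') k v := by
      intro k hk
      induction hk using ReflTransGen.head_induction_on with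
      | refl => exact fun _ => .refl
      | @head a b hab _ ih =>
        intro hai
        obtain ⟨⟨⟨haC, hbC, hne, y, hyS, hya, hy⟩, hbT⟩, hbi'⟩ := hab
        have hbi : b ≠ i := fun e => hi (e ▸ hbT)
        refine (ih hbi).head ⟨⟨haC, hbC, hne, y, hyS, ?_, ?_⟩, Finset.mem_erase.2 ⟨hbi', hbT⟩⟩
        · have : y ≠ x := by rintro rfl; exact hai (hya.symm.trans hxi)
          rw [Function.update_of_ne this, hya]
        · intro w hw hwb
          have : w ≠ x := by
            rintro rfl
            rw [Function.update_self] at hwb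
            exact hbi' hwb.symm
          rw [Function.update_of_ne this] at hwb
          exact hy w hw hwb
    obtain ⟨c', hc', hcard⟩ := ih (T.erase i') (Finset.erase_ssubset hi'T) _ i' hc1
      (Finset.notMem_erase _ _) (key i' (reflTransGen_avoid_start hrest)
        (fun e => hi (e ▸ hi'T)))
    refine ⟨c', hc', fun l => ?_⟩
    have h1 := hcard l
    have h2 := card_filter_update c hxS i' l
    rw [hxi] at h2
    omega

/-- `c` is a proper colouring whose classes have `s` elements, except that class `p` has one
element more and class `v` one element less. -/
structure IsNearlyEquitable (adj : V → V → Prop) (S : Finset V) (C : Finset ι) (s : ℕ)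
    (c : V → ι) (p v : ι) : Prop extends IsColouring adj S C c where
  large_mem : p ∈ C
  small_mem : v ∈ C
  card_class : ∀ l ∈ C, (S.filter fun y => c y = l).card + (if l = v then 1 else 0) =
    s + (if l = p then 1 else 0)

/-- There is a proper colouring of `S` by `C` with all classes of size `s`. -/
def HasEquitableColouring (adj : V → V → Prop) (S : Finset V) (C : Finset ι) (s : ℕ) : Prop :=
  ∃ c : V → ι, IsColouring adj S C c ∧ ∀ l ∈ C, (S.filter fun y => c y = l).card = s

lemma IsNearlyEquitable.hasEquitableColouring {adj : V → V → Prop}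
    (hs : ∀ x y, adj x y → adj y x) {S : Finset V} {C : Finset ι} {s : ℕ} {c : V → ι} {p v : ι}
    (hc : IsNearlyEquitable adj S C s c p v) (h : ReflTransGen (Movable adj S C c) p v) :
    HasEquitableColouring adj S C s := by
  obtain ⟨c', hc', hcard⟩ := exists_shift hs (C.erase p) c p hc.toIsColouring
    (Finset.notMem_erase _ _) (ReflTransGen.mono
      (fun a b hab => ⟨hab.1, Finset.mem_erase.2 ⟨hab.2, hab.1.2.1⟩⟩) _ _
      (reflTransGen_avoid_start h))
  refine ⟨c', hc', fun l hl => ?_⟩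
  have h1 := hcard l
  have h2 := hc.card_class l hl
  omega

/-- In a finite digraph in which all of `A` reaches `v`, there are a vertex `U` and a nonempty
set `T` of vertices with no edges to `A \ (T ∪ {U})`, none of which is needed by the others
to reach `v`. -/
lemma exists_terminal_set {E : ι → ι → Prop} {A : Finset ι} {v : ι} (hv : v ∈ A)
    (hA : ∀ i ∈ A, ReflTransGen E i v) {w : ι} (hw : w ∈ A) (hwv : w ≠ v) :
    ∃ U ∈ A, ∃ T ⊆ A, T.Nonempty ∧ U ∉ T ∧ v ∉ T ∧
      (∀ a ∈ T, ∀ b ∈ A, b ∉ T → b ≠ U → ¬ E a b) ∧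
      ∀ W ∈ T, ∀ i ∈ A, i ≠ W → ReflTransGen (fun a b => E a b ∧ a ≠ W ∧ b ≠ W) i v := by
  let T : ι → Finset ι := fun U => A.filter fun i =>
    i ≠ U ∧ ¬ ReflTransGen (fun a b => E a b ∧ a ≠ U ∧ b ≠ U) i v
  have hTv : w ∈ T v := by
    refine Finset.mem_filter.2 ⟨hw, hwv, fun h => ?_⟩
    rcases h.cases_tail with h | ⟨b, _, h⟩
    · exact hwv h.symm
    · exact h.2.2 rfl
  obtain ⟨U, hU, hmin⟩ := Finset.exists_min_image (A.filter fun U => (T U).Nonempty)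
    (fun U => (T U).card) ⟨v, Finset.mem_filter.2 ⟨hv, w, hTv⟩⟩
  rw [Finset.mem_filter] at hU
  refine ⟨U, hU.1, T U, Finset.filter_subset _ _, hU.2, by simp [T], ?_, ?_, ?_⟩
  · intro h
    rw [Finset.mem_filter] at h
    exact h.2.2 .refl
  · intro a ha b hb hbT hbU hab
    rw [Finset.mem_filter] at ha
    have : ReflTransGen (fun a b => E a b ∧ a ≠ U ∧ b ≠ U) b v := by
      by_contra h
      exact hbT (Finset.mem_filter.2 ⟨hb, hbU, h⟩)
    exact ha.2.2 (this.head ⟨hab, ha.2.1, hbU⟩)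
  · intro W hW
    have hW' := hW
    rw [Finset.mem_filter] at hW'
    obtain ⟨hWA, hWU, hWr⟩ := hW'
    have h1 : ∀ i, i ≠ U → ReflTransGen (fun a b => E a b ∧ b ≠ U) i v →
        ReflTransGen (fun a b => E a b ∧ a ≠ W ∧ b ≠ W) i v ∧
        ReflTransGen (fun a b => E a b ∧ a ≠ U ∧ b ≠ U) i v := by
      intro i hi h
      induction h using ReflTransGen.head_induction_on with
      | refl => exact ⟨.refl, .refl⟩
      | @head a b hab _ ih =>
        obtain ⟨i1, i2⟩ := ih hab.2
        have hr := i2.head (a := a) ⟨hab.1, hi, hab.2⟩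
        exact ⟨i1.head ⟨hab.1, fun e => hWr (e ▸ hr), fun e => hWr (e ▸ i2)⟩, hr⟩
    have hne : ¬ (T W).Nonempty := by
      intro hne
      have hsub : T W ⊂ T U := by
        refine Finset.ssubset_iff_subset_ne.2 ⟨?_, fun e => ?_⟩
        · intro i hi
          rw [Finset.mem_filter] at hi
          have hiU : i ≠ U := by
            rintro rfl
            refine hi.2.2 ?_
            rcases (reflTransGen_avoid_start (hA i hi.1)).cases_head with h | ⟨b, hab, h⟩
            · rw [h]
            · obtain ⟨i1, i2⟩ := h1 b hab.2 h
              exact i1.head ⟨hab.1, hi.2.1, fun e => hWr (e ▸ i2)⟩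
          refine Finset.mem_filter.2 ⟨hi.1, hiU, fun h => hi.2.2 (h1 i hiU ?_).1⟩
          exact ReflTransGen.mono (fun a b hab => ⟨hab.1, hab.2.2⟩) _ _ h
        · rw [← e] at hW
          simp [T] at hW
      exact absurd (hmin W (Finset.mem_filter.2 ⟨hWA, hne⟩))
        (not_le.2 (Finset.card_lt_card hsub))
    intro i hi hiW
    by_contra h
    exact hne ⟨i, Finset.mem_filter.2 ⟨hi, hiW, h⟩⟩

/-- `y` is the only vertex of its kind seen by the colour class of `z`: `z` is the unique neighbour
of `y` in the class of `z`. -/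
def IsSolo (adj : V → V → Prop) (S : Finset V) (c : V → ι) (z y : V) : Prop :=
  adj z y ∧ ∀ x ∈ S, c x = c z → adj y x → x = z

lemma card_le_card_filter_mem {P : Finset V} {c : V → ι} {I : Finset ι}
    (h : ∀ i ∈ I, ∃ y ∈ P, c y = i) : I.card ≤ (P.filter fun y => c y ∈ I).card := by
  refine (Finset.card_le_card (t := (P.filter fun y => c y ∈ I).image c) fun i hi => ?_).trans
    Finset.card_image_le
  obtain ⟨y, hy, rfl⟩ := h i hi
  exact Finset.mem_image_of_mem _ (Finset.mem_filter.2 ⟨hy, hi⟩)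

lemma exists_solo {adj : V → V → Prop} (hs : ∀ x y, adj x y → adj y x) {S : Finset V}
    {C : Finset ι} {s : ℕ} {c : V → ι} {p v U : ι} (hc : IsNearlyEquitable adj S C s c p v)
    (hdeg : ∀ x ∈ S, (S.filter fun y => adj x y).card < C.card)
    {A T : Finset ι} (hAC : A ⊆ C) (hvA : v ∈ A) (hpA : p ∉ A)
    (hB : ∀ y ∈ S, c y ∉ A → ∀ i ∈ A, ∃ x ∈ S, c x = i ∧ adj y x)
    (hTA : T ⊆ A) (hTne : T.Nonempty) (hvT : v ∉ T)
    (hT : ∀ x ∈ S, c x ∈ T → ∀ b ∈ A, b ∉ T → b ≠ U → ∃ y ∈ S, c y = b ∧ adj x y) :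
    ∃ z ∈ S, c z ∈ T ∧ ∃ y₁ ∈ S, c y₁ ∉ A ∧ IsSolo adj S c z y₁ ∧
      ((∃ X ∈ A, X ≠ c z ∧ ∀ y ∈ S, c y = X → ¬ adj z y) ∨
        ∃ y₂ ∈ S, c y₂ ∉ A ∧ y₂ ≠ y₁ ∧ IsSolo adj S c z y₂ ∧ ¬ adj y₁ y₂) := by
  by_contra hcon
  have hmov : ∀ z ∈ S, c z ∈ T → ∀ y ∈ S, c y ∉ A → IsSolo adj S c z y →
      ∀ X ∈ A, X ≠ c z → ∃ x ∈ S, c x = X ∧ adj z x := by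
    intro z hz hzT y hy hyA hzy X hX hXz
    by_contra h
    push Not at h
    exact hcon ⟨z, hz, hzT, y, hy, hyA, hzy, Or.inl ⟨X, hX, hXz, h⟩⟩
  have hclq : ∀ z ∈ S, c z ∈ T → ∀ y ∈ S, c y ∉ A → IsSolo adj S c z y →
      ∀ x ∈ S, c x ∉ A → x ≠ y → IsSolo adj S c z x → adj y x := by
    intro z hz hzT y hy hyA hzy x hx hxA hxy hzx
    by_contra h
    exact hcon ⟨z, hz, hzT, y, hy, hyA, hzy, Or.inr ⟨x, hx, hxA, hxy, hzx, h⟩⟩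
  clear hcon
  obtain ⟨q, hq⟩ : ∃ q, C.card = A.card + q := ⟨_, (Nat.add_sub_of_le
    (Finset.card_le_card hAC)).symm⟩
  have hpv : p ≠ v := fun e => hpA (e ▸ hvA)
  set B := S.filter fun y => c y ∉ A with hBdef
  have memB : ∀ y, y ∈ B ↔ y ∈ S ∧ c y ∉ A := fun y => Finset.mem_filter
  have hqc : (C \ A).card = q := by rw [Finset.card_sdiff_of_subset hAC, hq]; omega
  have hBcard : B.card = q * s + 1 := by
    have h1 : B.card = ∑ l ∈ C \ A, (S.filter fun y => c y = l).card := by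
      rw [Finset.card_eq_sum_card_fiberwise (f := c) (t := C \ A)]
      · refine Finset.sum_congr rfl fun l hl => ?_
        rw [hBdef, Finset.filter_filter]
        congr 1
        ext y
        simp only [Finset.mem_filter, Finset.mem_sdiff] at hl ⊢
        constructor
        · tauto
        · rintro ⟨h1, rfl⟩; tauto
      · intro y hy
        have := (memB y).1 hy
        exact Finset.mem_coe.2 (Finset.mem_sdiff.2 ⟨hc.mem y this.1, this.2⟩)
    have h2 : ∀ l ∈ C \ A, (S.filter fun y => c y = l).card = s + (if l = p then 1 else 0) := by
      intro l hl
      rw [Finset.mem_sdiff] at hl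
      have := hc.card_class l hl.1
      rwa [if_neg (fun e : l = v => hl.2 (e ▸ hvA)), add_zero] at this
    rw [h1, Finset.sum_congr rfl h2, Finset.sum_add_distrib, Finset.sum_const, hqc,
      Finset.sum_ite_eq', if_pos (Finset.mem_sdiff.2 ⟨hc.large_mem, hpA⟩), smul_eq_mul]
  have hTcard : ∀ l ∈ T, (S.filter fun y => c y = l).card = s := by
    intro l hl
    have := hc.card_class l (hAC (hTA hl))
    rwa [if_neg (fun e : l = v => hvT (e ▸ hl)), if_neg (fun e : l = p => hpA (e ▸ hTA hl))] at this
  have hsplit : ∀ x ∈ S, ((S.filter fun y => adj x y).filter fun y => c y ∈ A).card +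
      (B.filter fun y => adj x y).card < A.card + q := by
    intro x hx
    rw [← hq]
    refine lt_of_eq_of_lt ?_ (hdeg x hx)
    rw [← Finset.card_filter_add_card_filter_not (s := S.filter fun y => adj x y)
      (fun y => c y ∈ A), hBdef, Finset.filter_comm (s := S) (fun y => c y ∉ A)]
  have hsub : ∀ x ∈ S, ∀ I ⊆ A, (∀ i ∈ I, ∃ y ∈ S, c y = i ∧ adj x y) →
      I.card + (B.filter fun y => adj x y).card < A.card + q := by
    intro x hx I hI h
    refine lt_of_le_of_lt (Nat.add_le_add_right ?_ _) (hsplit x hx)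
    refine (card_le_card_filter_mem (P := S.filter fun y => adj x y) (c := c) fun i hi => ?_).trans
      (Finset.card_le_card fun y hy => ?_)
    · obtain ⟨y, hy, h1, h2⟩ := h i hi
      exact ⟨y, Finset.mem_filter.2 ⟨hy, h2⟩, h1⟩
    · rw [Finset.mem_filter] at hy ⊢
      exact ⟨hy.1, hI hy.2⟩
  have hdT : ∀ x ∈ S, c x ∈ T → (B.filter fun y => adj x y).card ≤ q + T.card := by
    intro x hx hxT
    have h1 := hsub x hx ((A \ T).erase U) (fun i hi => (Finset.mem_sdiff.1
      (Finset.mem_of_mem_erase hi)).1) (fun i hi => hT x hx hxT i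
        (Finset.mem_sdiff.1 (Finset.mem_of_mem_erase hi)).1
        (Finset.mem_sdiff.1 (Finset.mem_of_mem_erase hi)).2 (Finset.ne_of_mem_erase hi))
    have h2 := Finset.pred_card_le_card_erase (s := A \ T) (a := U)
    rw [Finset.card_sdiff_of_subset hTA] at h2
    have h3 := Finset.card_le_card hTA
    omega
  have hdsolo : ∀ z ∈ S, c z ∈ T → (∃ y ∈ B, IsSolo adj S c z y) →
      (B.filter fun y => adj z y).card ≤ q := by
    rintro z hz hzT ⟨y, hy, hzy⟩
    rw [memB] at hy
    have h1 := hsub z hz (A.erase (c z)) (Finset.erase_subset _ _) (fun i hi =>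
      hmov z hz hzT y hy.1 hy.2 hzy i (Finset.mem_of_mem_erase hi) (Finset.ne_of_mem_erase hi))
    rw [Finset.card_erase_of_mem (hTA hzT)] at h1
    have := Finset.card_pos.2 ⟨_, hTA hzT⟩
    omega
  have hsolo_count : ∀ y ∈ B, T.card + (B.filter fun x => adj y x).card + 1 ≤
      q + ((S.filter fun z => c z ∈ T).filter fun z => IsSolo adj S c z y).card := by
    intro y hy
    have hy' := (memB y).1 hy
    have h1 := hsplit y hy'.1
    rw [Finset.card_eq_sum_card_fiberwise (f := c) (t := A)
      (s := (S.filter fun x => adj y x).filter fun x => c x ∈ A)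
      (fun x hx => (Finset.mem_filter.1 hx).2)] at h1
    have h2 : ∀ i ∈ A, 1 + (if i ∈ T then 1 else 0) ≤
        (((S.filter fun x => adj y x).filter fun x => c x ∈ A).filter fun x => c x = i).card +
        (if i ∈ ((S.filter fun z => c z ∈ T).filter fun z => IsSolo adj S c z y).image c
          then 1 else 0) := by
      intro i hi
      obtain ⟨x, hx, hxi, hyx⟩ := hB y hy'.1 hy'.2 i hi
      have hmem : x ∈ ((S.filter fun x => adj y x).filter fun x => c x ∈ A).filter
          fun x => c x = i := by
        simp only [Finset.mem_filter]
        exact ⟨⟨⟨hx, hyx⟩, hxi ▸ hi⟩, hxi⟩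
      have hpos := Finset.card_pos.2 ⟨x, hmem⟩
      by_cases hiT : i ∈ T
      · by_cases hsolo : IsSolo adj S c x y
        · have : i ∈ ((S.filter fun z => c z ∈ T).filter
              fun z => IsSolo adj S c z y).image c := by
            refine Finset.mem_image.2 ⟨x, ?_, hxi⟩
            simp only [Finset.mem_filter]
            exact ⟨⟨hx, hxi ▸ hiT⟩, hsolo⟩
          rw [if_pos hiT, if_pos this]
          omega
        · have : ∃ x' ∈ S, c x' = c x ∧ adj y x' ∧ x' ≠ x := by
            by_contra h
            push Not at h
            exact hsolo ⟨hs _ _ hyx, h⟩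
          obtain ⟨x', hx', hcx, hyx', hne⟩ := this
          have h3 : 1 < (((S.filter fun x => adj y x).filter fun x => c x ∈ A).filter
              fun x => c x = i).card := by
            refine Finset.one_lt_card.2 ⟨x', ?_, x, hmem, hne⟩
            simp only [Finset.mem_filter]
            exact ⟨⟨⟨hx', hyx'⟩, by rw [hcx, hxi]; exact hi⟩, hcx.trans hxi⟩
          rw [if_pos hiT]
          omega
      · rw [if_neg hiT]
        omega
    have h3 := Finset.sum_le_sum h2
    rw [Finset.sum_add_distrib, Finset.sum_add_distrib, ← Finset.card_filter,
      ← Finset.card_filter, Finset.sum_const, smul_eq_mul, mul_one,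
      Finset.filter_mem_eq_inter, Finset.filter_mem_eq_inter,
      Finset.inter_eq_right.2 hTA] at h3
    have h4 := (Finset.card_le_card (Finset.inter_subset_right (s₁ := A)
      (s₂ := ((S.filter fun z => c z ∈ T).filter fun z => IsSolo adj S c z y).image c))).trans
      Finset.card_image_le
    omega
  have hqpos : 0 < q := by
    rw [← hqc]
    exact Finset.card_pos.2 ⟨p, Finset.mem_sdiff.2 ⟨hc.large_mem, hpA⟩⟩
  have hqt : q < T.card := by
    by_contra hle
    push Not at hle
    obtain ⟨W, hW⟩ := hTne
    let wt : V → ℕ := fun z => if ∃ y ∈ B, IsSolo adj S c z y then 2 else 1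
    have h1 : ∑ y ∈ B, ∑ z ∈ S.filter (fun z => c z = W), (if adj z y then wt z else 0) =
        ∑ z ∈ S.filter (fun z => c z = W), (B.filter fun y => adj z y).card * wt z := by
      rw [Finset.sum_comm]
      refine Finset.sum_congr rfl fun z _ => ?_
      rw [← Finset.sum_filter, Finset.sum_const, smul_eq_mul]
    have h2 : ∑ z ∈ S.filter (fun z => c z = W), (B.filter fun y => adj z y).card * wt z ≤
        s * (2 * q) := by
      rw [← hTcard W hW, ← smul_eq_mul]
      refine Finset.sum_le_card_nsmul _ _ _ fun z hz => ?_
      rw [Finset.mem_filter] at hz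
      have hzT : c z ∈ T := hz.2 ▸ hW
      by_cases h : ∃ y ∈ B, IsSolo adj S c z y
      · simp only [wt, if_pos h]
        have := hdsolo z hz.1 hzT h
        omega
      · simp only [wt, if_neg h]
        have := hdT z hz.1 hzT
        omega
    have h3 : B.card * 2 ≤
        ∑ y ∈ B, ∑ z ∈ S.filter (fun z => c z = W), (if adj z y then wt z else 0) := by
      rw [← smul_eq_mul]
      refine Finset.card_nsmul_le_sum _ _ _ fun y hy => ?_
      have hy' := (memB y).1 hy
      obtain ⟨x, hx, hxi, hyx⟩ := hB y hy'.1 hy'.2 W (hTA hW)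
      have hxW : x ∈ S.filter fun z => c z = W := Finset.mem_filter.2 ⟨hx, hxi⟩
      by_cases h : IsSolo adj S c x y
      · refine le_trans ?_ (Finset.single_le_sum (fun _ _ => Nat.zero_le _) hxW)
        simp only [wt, if_pos (hs _ _ hyx), if_pos (⟨y, hy, h⟩ : ∃ y ∈ B, IsSolo adj S c x y)]
        exact le_refl _
      · have : ∃ x' ∈ S, c x' = c x ∧ adj y x' ∧ x' ≠ x := by
          by_contra h'
          push Not at h'
          exact h ⟨hs _ _ hyx, h'⟩
        obtain ⟨x', hx', hcx, hyx', hne⟩ := this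
        have hsub2 : ({x, x'} : Finset V) ⊆ S.filter fun z => c z = W := by
          intro w hw
          rw [Finset.mem_insert, Finset.mem_singleton] at hw
          rcases hw with rfl | rfl
          · exact hxW
          · exact Finset.mem_filter.2 ⟨hx', hcx.trans hxi⟩
        refine le_trans ?_ (Finset.sum_le_sum_of_subset hsub2)
        rw [Finset.sum_pair hne.symm, if_pos (hs _ _ hyx), if_pos (hs _ _ hyx')]
        have hwt : ∀ z, 1 ≤ wt z := by
          intro z
          simp only [wt]
          split_ifs <;> omega
        have := hwt x
        have := hwt x'
        omega
    rw [h1, hBcard] at h3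
    have h4 := h3.trans h2
    nlinarith
  let wt : V → ℚ := fun z => (q : ℚ) / ((B.filter fun y => IsSolo adj S c z y).card : ℚ)
  have hzsum : ∀ z, ∑ y ∈ B, (if IsSolo adj S c z y then wt z else 0) ≤ q := by
    intro z
    rw [← Finset.sum_filter, Finset.sum_const, nsmul_eq_mul]
    by_cases h : ((B.filter fun y => IsSolo adj S c z y).card : ℚ) = 0
    · rw [h]; simp
    · simp only [wt]
      rw [mul_div_cancel₀ _ h]
  have hysum : ∀ y ∈ B, (T.card : ℚ) ≤
      ∑ z ∈ S.filter (fun z => c z ∈ T), (if IsSolo adj S c z y then wt z else 0) := by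
    intro y hy
    have hy' := (memB y).1 hy
    set d := (B.filter fun x => adj y x).card with hd
    rw [← Finset.sum_filter]
    have h1 : ∀ z ∈ (S.filter fun z => c z ∈ T).filter (fun z => IsSolo adj S c z y),
        (q : ℚ) / (d + 1) ≤ wt z := by
      intro z hz
      simp only [Finset.mem_filter] at hz
      obtain ⟨⟨hzS, hzT⟩, hzy⟩ := hz
      have hle : (B.filter fun y => IsSolo adj S c z y).card ≤ d + 1 := by
        refine (Finset.card_le_card (t := insert y (B.filter fun x => adj y x)) ?_).trans
          (Finset.card_insert_le _ _)
        intro x hx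
        simp only [Finset.mem_filter, memB] at hx
        rw [Finset.mem_insert, Finset.mem_filter, memB]
        by_cases hxy : x = y
        · exact Or.inl hxy
        · exact Or.inr ⟨hx.1, hclq z hzS hzT y hy'.1 hy'.2 hzy x hx.1.1 hx.1.2 hxy hx.2⟩
      have hpos : 0 < (B.filter fun y => IsSolo adj S c z y).card :=
        Finset.card_pos.2 ⟨y, Finset.mem_filter.2 ⟨hy, hzy⟩⟩
      refine div_le_div_of_nonneg_left (Nat.cast_nonneg _) (by exact_mod_cast hpos) ?_
      exact_mod_cast hle
    have h2 := Finset.card_nsmul_le_sum _ _ _ h1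
    refine le_trans ?_ h2
    rw [nsmul_eq_mul]
    have h3 := hsolo_count y hy
    have hdq : d + 1 ≤ q := by
      have := hsub y hy'.1 A subset_rfl (hB y hy'.1 hy'.2)
      omega
    set m := ((S.filter fun z => c z ∈ T).filter fun z => IsSolo adj S c z y).card
    have h3' : (T.card : ℚ) + d + 1 ≤ q + m := by exact_mod_cast h3
    have hdq' : (d : ℚ) + 1 ≤ q := by exact_mod_cast hdq
    have hqt' : (q : ℚ) ≤ T.card := by exact_mod_cast hqt.le
    have hd0 : (0 : ℚ) < d + 1 := by positivity
    rw [mul_div_assoc', le_div_iff₀ hd0]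
    nlinarith
  have htotal : (B.card : ℚ) * T.card ≤ ((S.filter fun z => c z ∈ T).card : ℚ) * q := by
    rw [← nsmul_eq_mul, ← nsmul_eq_mul]
    refine (Finset.card_nsmul_le_sum _ _ _ hysum).trans ?_
    rw [Finset.sum_comm]
    exact Finset.sum_le_card_nsmul _ _ _ fun z _ => hzsum z
  have hTs : (S.filter fun z => c z ∈ T).card = T.card * s := by
    rw [Finset.card_eq_sum_card_fiberwise (f := c) (t := T)
      (s := S.filter fun z => c z ∈ T) (fun x hx => (Finset.mem_filter.1 hx).2), ← smul_eq_mul, ← Finset.sum_const]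
    refine Finset.sum_congr rfl fun l hl => ?_
    rw [← hTcard l hl, Finset.filter_filter]
    congr 1
    ext y
    simp only [Finset.mem_filter]
    constructor
    · tauto
    · rintro ⟨h, rfl⟩; tauto
  have htotal' : B.card * T.card ≤ (S.filter fun z => c z ∈ T).card * q := by
    exact_mod_cast htotal
  rw [hBcard, hTs] at htotal'
  nlinarith

lemma card_filter_insert_recolour {S : Finset V} {c₀ : V → ι} {y z : V} (hy : y ∈ S) (hz : z ∈ S)
    (hzy : z ≠ y) (Z l : ι) :
    (S.filter fun x => (if x = y then c₀ z else if x = z then Z else c₀ x) = l).card =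
      ((S.erase y).filter fun x => c₀ x = l).card + (if l = Z then 1 else 0) := by
  have hz' : z ∈ S.erase y := Finset.mem_erase.2 ⟨hzy, hz⟩
  rw [Finset.card_filter, Finset.card_filter, ← Finset.add_sum_erase _ _ hy,
    ← Finset.add_sum_erase _ _ hz', ← Finset.add_sum_erase (S.erase y) _ hz', if_pos rfl,
    if_neg hzy, if_pos rfl]
  have : ∑ x ∈ (S.erase y).erase z,
      (if (if x = y then c₀ z else if x = z then Z else c₀ x) = l then 1 else 0) =
      ∑ x ∈ (S.erase y).erase z, (if c₀ x = l then 1 else 0) := by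
    refine Finset.sum_congr rfl fun x hx => ?_
    rw [Finset.mem_erase, Finset.mem_erase] at hx
    rw [if_neg hx.2.1, if_neg hx.1]
  rw [this]
  simp only [eq_comm (a := l)]
  ring

lemma IsNearlyEquitable.exists_of_induction {adj : V → V → Prop}
    (hs : ∀ x y, adj x y → adj y x) {S : Finset V} {C : Finset ι} {s : ℕ}
    (hdeg : ∀ x ∈ S, (S.filter fun y => adj x y).card < C.card)
    (ih : ∀ B ⊆ S, ∀ D : Finset ι, (∃ x ∈ S, x ∉ B ∧ ∃ y ∈ S, adj x y) →
      B.card = D.card * s → (∀ x ∈ B, (B.filter fun y => adj x y).card < D.card) →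
      HasEquitableColouring adj B D s) (N : ℕ) :
    ∀ (c : V → ι) (p v : ι), IsNearlyEquitable adj S C s c p v →
      (C.filter fun i => ¬ ReflTransGen (Movable adj S C c) i v).card ≤ N →
      HasEquitableColouring adj S C s := by
  induction N with
  | zero =>
    intro c p v hc hN
    refine hc.hasEquitableColouring hs ?_
    by_contra h
    have hmem : p ∈ C.filter fun i => ¬ ReflTransGen (Movable adj S C c) i v :=
      Finset.mem_filter.2 ⟨hc.large_mem, h⟩
    rw [Finset.card_eq_zero.1 (Nat.le_zero.1 hN)] at hmem
    exact Finset.notMem_empty _ hmem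
  | succ N ihN =>
    intro c p v hc hN
    by_cases hp : ReflTransGen (Movable adj S C c) p v
    · exact hc.hasEquitableColouring hs hp
    set A := C.filter fun i => ReflTransGen (Movable adj S C c) i v with hA
    have hAC : A ⊆ C := Finset.filter_subset _ _
    have memA : ∀ i, i ∈ A ↔ i ∈ C ∧ ReflTransGen (Movable adj S C c) i v :=
      fun i => Finset.mem_filter
    have hvA : v ∈ A := (memA v).2 ⟨hc.small_mem, .refl⟩
    have hpA : p ∉ A := fun h => hp ((memA p).1 h).2
    have hpv : p ≠ v := fun e => hpA (e ▸ hvA)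
    have hB : ∀ y ∈ S, c y ∉ A → ∀ i ∈ A, ∃ x ∈ S, c x = i ∧ adj y x := by
      intro y hy hyA i hi
      by_contra h
      push Not at h
      exact hyA ((memA _).2 ⟨hc.mem y hy, ((memA i).1 hi).2.head
        ⟨hc.mem y hy, hAC hi, fun e => hyA (e ▸ hi), y, hy, rfl, h⟩⟩)
    have hcardB : ∀ x ∈ S, c x ∉ A →
        A.card + ((S.filter fun y => c y ∉ A).filter fun y => adj x y).card < C.card := by
      intro x hx hxA
      refine lt_of_le_of_lt ?_ (hdeg x hx)
      rw [← Finset.card_filter_add_card_filter_not (s := S.filter fun y => adj x y)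
        (fun y => c y ∈ A), Finset.filter_comm (s := S) (fun y => c y ∉ A)]
      refine Nat.add_le_add_right (card_le_card_filter_mem fun i hi => ?_) _
      obtain ⟨y, hy, h1, h2⟩ := hB x hx hxA i hi
      exact ⟨y, Finset.mem_filter.2 ⟨hy, h2⟩, h1⟩
    have hclassB : ∀ l ∈ C, l ∉ A →
        (S.filter fun y => c y = l).card = s + (if l = p then 1 else 0) := by
      intro l hl hlA
      have := hc.card_class l hl
      rwa [if_neg (fun e : l = v => hlA (e ▸ hvA)), add_zero] at this
    have hSB : (S.filter fun y => c y ∉ A).card = (C \ A).card * s + 1 := by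
      rw [Finset.card_eq_sum_card_fiberwise (f := c) (t := C \ A)
        (s := S.filter fun y => c y ∉ A) (fun y hy => by
          have := Finset.mem_filter.1 hy
          exact Finset.mem_coe.2 (Finset.mem_sdiff.2 ⟨hc.mem y this.1, this.2⟩))]
      have : ∀ l ∈ C \ A, ((S.filter fun y => c y ∉ A).filter fun y => c y = l).card =
          s + (if l = p then 1 else 0) := by
        intro l hl
        rw [Finset.mem_sdiff] at hl
        rw [← hclassB l hl.1 hl.2, Finset.filter_filter]
        congr 1
        ext y
        simp only [Finset.mem_filter]
        constructor
        · tauto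
        · rintro ⟨h1, rfl⟩; tauto
      rw [Finset.sum_congr rfl this, Finset.sum_add_distrib, Finset.sum_const,
        Finset.sum_ite_eq', if_pos (Finset.mem_sdiff.2 ⟨hc.large_mem, hpA⟩), smul_eq_mul]
    have hw : ∃ w ∈ A, w ≠ v := by
      by_contra h
      push Not at h
      have h1 : (S.filter fun y => c y ∉ A).card ≤
          ∑ x ∈ S.filter (fun x => c x = v), (S.filter fun y => adj x y).card := by
        refine (Finset.card_le_card (t := (S.filter fun x => c x = v).biUnion
          fun x => S.filter fun y => adj x y) fun y hy => ?_).trans Finset.card_biUnion_le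
        rw [Finset.mem_filter] at hy
        obtain ⟨x, hx, hxv, hyx⟩ := hB y hy.1 hy.2 v hvA
        exact Finset.mem_biUnion.2 ⟨x, Finset.mem_filter.2 ⟨hx, hxv⟩,
          Finset.mem_filter.2 ⟨hy.1, hs _ _ hyx⟩⟩
      have h2 : ∑ x ∈ S.filter (fun x => c x = v), (S.filter fun y => adj x y).card ≤
          (S.filter fun x => c x = v).card * (C.card - 1) := by
        rw [← smul_eq_mul]
        exact Finset.sum_le_card_nsmul _ _ _ fun x hx =>
          Nat.le_sub_one_of_lt (hdeg x (Finset.mem_filter.1 hx).1)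
      have h3 := hc.card_class v hc.small_mem
      rw [if_pos rfl, if_neg hpv.symm] at h3
      have h4 : A.card = 1 := Finset.card_eq_one.2 ⟨v, Finset.eq_singleton_iff_unique_mem.2 ⟨hvA, h⟩⟩
      rw [hSB, Finset.card_sdiff_of_subset hAC, h4] at h1
      have h5 := h1.trans h2
      have h6 : (S.filter fun x => c x = v).card * (C.card - 1) ≤ s * (C.card - 1) :=
        Nat.mul_le_mul_right _ (by omega)
      rw [mul_comm s] at h6
      omega
    obtain ⟨w, hwA, hwv⟩ := hw
    obtain ⟨U, hUA, T, hTA, hTne, hUT, hvT, hTU, hterm⟩ :=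
      exists_terminal_set hvA (fun i hi => ((memA i).1 hi).2) hwA hwv
    have hT : ∀ x ∈ S, c x ∈ T → ∀ b ∈ A, b ∉ T → b ≠ U → ∃ y ∈ S, c y = b ∧ adj x y := by
      intro x hx hxT b hb hbT hbU
      by_contra h
      push Not at h
      exact hTU _ hxT b hb hbT hbU
        ⟨hAC (hTA hxT), hAC hb, fun e => hbT (e ▸ hxT), x, hx, rfl, h⟩
    obtain ⟨z, hzS, hzT, y, hyS, hyA, hzy, hor⟩ :=
      exists_solo hs hc hdeg hAC hvA hpA hB hTA hTne hvT hT
    have hzA := hTA hzT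
    have hzney : z ≠ y := fun e => hyA (e ▸ hzA)
    have hzv : c z ≠ v := fun e => hvT (e ▸ hzT)
    -- an equitable colouring of the inaccessible part without `y`
    obtain ⟨g, hg, hgcard⟩ := ih ((S.filter fun x => c x ∉ A).erase y)
      ((Finset.erase_subset _ _).trans (Finset.filter_subset _ _)) (C \ A)
      ⟨y, hyS, Finset.notMem_erase _ _, z, hzS, hs _ _ hzy.1⟩
      (by rw [Finset.card_erase_of_mem (Finset.mem_filter.2 ⟨hyS, hyA⟩), hSB]; rfl)
      (by
        intro x hx
        rw [Finset.mem_erase, Finset.mem_filter] at hx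
        have h1 := hcardB x hx.2.1 hx.2.2
        have h2 := Finset.card_le_card (Finset.filter_subset_filter (fun y => adj x y)
          (Finset.erase_subset y (S.filter fun x => c x ∉ A)))
        rw [Finset.card_sdiff_of_subset hAC]
        omega)
    have hgmem : ∀ x ∈ S, x ≠ y → c x ∉ A → g x ∈ C ∧ g x ∉ A := fun x hx hxy hxA =>
      Finset.mem_sdiff.1 (hg.mem x (Finset.mem_erase.2 ⟨hxy, Finset.mem_filter.2 ⟨hx, hxA⟩⟩))
    let c₀ : V → ι := fun x => if c x ∈ A then c x else g x
    have hc₀A : ∀ x ∈ S, x ≠ y → ∀ a ∈ A, (c₀ x = a ↔ c x = a) := by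
      intro x hx hxy a ha
      by_cases h : c x ∈ A
      · simp only [c₀, if_pos h]
      · simp only [c₀, if_neg h]
        exact ⟨fun e => absurd (e ▸ ha) (hgmem x hx hxy h).2, fun e => absurd (e ▸ ha) h⟩
    have hc₀z : c₀ z = c z := if_pos hzA
    have hc₀C : ∀ x ∈ S, x ≠ y → c₀ x ∈ C := by
      intro x hx hxy
      by_cases h : c x ∈ A
      · simp only [c₀, if_pos h]; exact hAC h
      · simp only [c₀, if_neg h]; exact (hgmem x hx hxy h).1
    have hc₀ne : ∀ x₁ ∈ S, x₁ ≠ y → ∀ x₂ ∈ S, x₂ ≠ y → adj x₁ x₂ → c₀ x₁ ≠ c₀ x₂ := by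
      intro x₁ h1 h1y x₂ h2 h2y hadj
      by_cases h : c x₁ ∈ A
      · intro e
        have e1 : c₀ x₁ = c x₁ := if_pos h
        rw [e1] at e
        exact hc.ne x₁ h1 x₂ h2 hadj ((hc₀A x₂ h2 h2y _ h).1 e.symm).symm
      · by_cases h' : c x₂ ∈ A
        · intro e
          have e1 : c₀ x₂ = c x₂ := if_pos h'
          rw [e1] at e
          exact hc.ne x₁ h1 x₂ h2 hadj ((hc₀A x₁ h1 h1y _ h').1 e)
        · simp only [c₀, if_neg h, if_neg h']
          exact hg.ne x₁ (Finset.mem_erase.2 ⟨h1y, Finset.mem_filter.2 ⟨h1, h⟩⟩)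
            x₂ (Finset.mem_erase.2 ⟨h2y, Finset.mem_filter.2 ⟨h2, h'⟩⟩) hadj
    have hc₀card : ∀ l ∈ C, ((S.erase y).filter fun x => c₀ x = l).card +
        (if l = v then 1 else 0) = s := by
      intro l hl
      by_cases hlA : l ∈ A
      · have h1 := hc.card_class l hl
        rw [if_neg (fun e : l = p => hpA (e ▸ hlA)), add_zero] at h1
        rw [← h1]
        congr 2
        ext x
        simp only [Finset.mem_filter, Finset.mem_erase]
        constructor
        · rintro ⟨⟨h1, h2⟩, h3⟩
          exact ⟨h2, (hc₀A x h2 h1 l hlA).1 h3⟩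
        · rintro ⟨h2, h3⟩
          have hxy : x ≠ y := by rintro rfl; exact hyA (h3 ▸ hlA)
          exact ⟨⟨hxy, h2⟩, (hc₀A x h2 hxy l hlA).2 h3⟩
      · rw [if_neg (fun e : l = v => hlA (e ▸ hvA)), add_zero,
          ← hgcard l (Finset.mem_sdiff.2 ⟨hl, hlA⟩)]
        congr 1
        ext x
        simp only [Finset.mem_filter, Finset.mem_erase]
        constructor
        · rintro ⟨⟨h1, h2⟩, h3⟩
          by_cases h : c x ∈ A
          · simp only [c₀, if_pos h] at h3; exact absurd (h3 ▸ h) hlA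
          · simp only [c₀, if_neg h] at h3; exact ⟨⟨h1, h2, h⟩, h3⟩
        · rintro ⟨⟨h1, h2, h⟩, h3⟩
          simp only [c₀, if_neg h]; exact ⟨⟨h1, h2⟩, h3⟩
    let c' : ι → V → ι := fun Z x => if x = y then c₀ z else if x = z then Z else c₀ x
    have hc'y : ∀ Z, c' Z y = c z := fun Z => by simp only [c', if_pos]; exact hc₀z
    have hc'z : ∀ Z, c' Z z = Z := fun Z => by simp only [c', if_neg hzney, if_pos]
    have hc'o : ∀ Z x, x ≠ y → x ≠ z → c' Z x = c₀ x := fun Z x h1 h2 => by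
      simp only [c', if_neg h1, if_neg h2]
    have hnear : ∀ Z ∈ C, Z ≠ c z → (∀ x ∈ S, x ≠ y → c₀ x = Z → ¬ adj z x) →
        IsNearlyEquitable adj S C s (c' Z) Z v := by
      intro Z hZ hZz hZadj
      have hyne : ∀ x ∈ S, adj y x → c' Z x ≠ c z := by
        intro x hx hyx
        have hxy : x ≠ y := by rintro rfl; exact hc.ne x hx x hx hyx rfl
        by_cases hxz : x = z
        · rw [hxz, hc'z]; exact hZz
        · rw [hc'o Z x hxy hxz]
          exact fun e => hxz (hzy.2 x hx ((hc₀A x hx hxy _ hzA).1 e) hyx)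
      have hzne : ∀ x ∈ S, x ≠ y → adj z x → c' Z x ≠ Z := by
        intro x hx hxy hzx
        have hxz : x ≠ z := by rintro rfl; exact hc.ne x hx x hx hzx rfl
        rw [hc'o Z x hxy hxz]
        exact fun e => hZadj x hx hxy e hzx
      refine ⟨⟨fun x hx => ?_, fun x₁ h1 x₂ h2 hadj => ?_⟩, hZ, hc.small_mem, fun l hl => ?_⟩
      · by_cases hxy : x = y
        · rw [hxy, hc'y]; exact hAC hzA
        · by_cases hxz : x = z
          · rw [hxz, hc'z]; exact hZ
          · rw [hc'o Z x hxy hxz]; exact hc₀C x hx hxy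
      · by_cases h1y : x₁ = y
        · rw [h1y] at hadj ⊢
          rw [hc'y]; exact (hyne x₂ h2 hadj).symm
        by_cases h2y : x₂ = y
        · rw [h2y] at hadj ⊢
          rw [hc'y]; exact hyne x₁ h1 (hs _ _ hadj)
        by_cases h1z : x₁ = z
        · rw [h1z] at hadj ⊢
          rw [hc'z]; exact (hzne x₂ h2 h2y hadj).symm
        by_cases h2z : x₂ = z
        · rw [h2z] at hadj ⊢
          rw [hc'z]; exact hzne x₁ h1 h1y (hs _ _ hadj)
        rw [hc'o Z x₁ h1y h1z, hc'o Z x₂ h2y h2z]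
        exact hc₀ne x₁ h1 h1y x₂ h2 h2y hadj
      · have e1 := card_filter_insert_recolour (c₀ := c₀) hyS hzS hzney Z l
        have e2 := hc₀card l hl
        simp only [c'] at *
        omega
    -- old moves between accessible classes other than that of `z` survive
    have hmove : ∀ Z a b, a ∈ A → b ∈ A → b ≠ c z → b ≠ Z → (∃ x ∈ S, x ≠ z ∧ c x = a ∧
        ∀ y ∈ S, c y = b → ¬ adj x y) → a ≠ b → Movable adj S C (c' Z) a b := by
      rintro Z a b ha hb hbz hbZ ⟨x, hx, hxz, hxa, hxb⟩ hab
      have hxy : x ≠ y := by rintro rfl; exact hyA (hxa ▸ ha)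
      refine ⟨hAC ha, hAC hb, hab, x, hx, ?_, fun x' hx' hx'b => hxb x' hx' ?_⟩
      · rw [hc'o Z x hxy hxz]; exact (hc₀A x hx hxy a ha).2 hxa
      · by_cases h1 : x' = y
        · rw [h1, hc'y] at hx'b; exact absurd hx'b.symm hbz
        by_cases h2 : x' = z
        · rw [h2, hc'z] at hx'b; exact absurd hx'b.symm hbZ
        rw [hc'o Z x' h1 h2] at hx'b
        exact (hc₀A x' hx' h1 b hb).1 hx'b
    have hreach : ∀ Z i, i ∈ A → i ≠ c z →
        ReflTransGen (fun a b => (Movable adj S C c a b ∧ a ≠ c z ∧ b ≠ c z) ∧ b ≠ Z) i v →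
        ReflTransGen (Movable adj S C (c' Z)) i v := by
      intro Z i hi hiz h
      induction h using ReflTransGen.head_induction_on with
      | refl => exact .refl
      | @head a b hab hbv ih' =>
        have hbA : b ∈ A := (memA b).2 ⟨hab.1.1.2.1,
          ReflTransGen.mono (fun _ _ h => h.1.1) _ _ hbv⟩
        refine (ih' hbA hab.1.2.2).head (hmove Z a b hi hbA hab.1.2.2 hab.2 ?_ hab.1.1.2.2.1)
        obtain ⟨x, hx, hxa, hxb⟩ := hab.1.1.2.2.2
        exact ⟨x, hx, by rintro rfl; exact hiz hxa.symm, hxa, hxb⟩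
    by_cases hcase : ∃ X ∈ A, X ≠ c z ∧ ∀ y ∈ S, c y = X → ¬ adj z y
    · obtain ⟨X, hX, hXz, hXadj⟩ := hcase
      refine (hnear X (hAC hX) hXz fun x hx hxy hxX =>
        hXadj x hx ((hc₀A x hx hxy X hX).1 hxX)).hasEquitableColouring hs ?_
      exact hreach X X hX hXz (reflTransGen_avoid_start (hterm (c z) hzT X hX hXz))
    obtain ⟨y₂, hy₂S, hy₂A, hy₂y, hzy₂, hyy₂⟩ := hor.resolve_left hcase
    push Not at hcase
    have hY : ∃ Y ∈ C \ A, ∀ x ∈ S, x ≠ y → c₀ x = Y → ¬ adj z x := by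
      by_contra h
      push Not at h
      have h1 : (C \ A).card + (A.erase (c z)).card ≤
          ((S.filter fun x => adj z x).erase y).card := by
        rw [← Finset.card_union_of_disjoint]
        · refine (Finset.card_le_card
            (t := ((S.filter fun x => adj z x).erase y).image c₀) fun i hi => ?_).trans
            Finset.card_image_le
          rw [Finset.mem_image]
          rcases Finset.mem_union.1 hi with hi | hi
          · obtain ⟨x, hx, hxy, hxi, hzx⟩ := h i hi
            exact ⟨x, Finset.mem_erase.2 ⟨hxy, Finset.mem_filter.2 ⟨hx, hzx⟩⟩, hxi⟩
          · rw [Finset.mem_erase] at hi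
            obtain ⟨x, hx, hxi, hzx⟩ := hcase i hi.2 hi.1
            have hxy : x ≠ y := by rintro rfl; exact hyA (hxi ▸ hi.2)
            exact ⟨x, Finset.mem_erase.2 ⟨hxy, Finset.mem_filter.2 ⟨hx, hzx⟩⟩,
              (hc₀A x hx hxy i hi.2).2 hxi⟩
        · exact Finset.disjoint_left.2 fun i h1 h2 =>
            (Finset.mem_sdiff.1 h1).2 (Finset.mem_of_mem_erase h2)
      rw [Finset.card_erase_of_mem (Finset.mem_filter.2 ⟨hyS, hzy.1⟩),
        Finset.card_erase_of_mem hzA, Finset.card_sdiff_of_subset hAC] at h1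
      have h2 : (S.filter (adj z)).card < C.card := hdeg z hzS
      have h3 := Finset.card_le_card hAC
      have h4 := Finset.card_pos.2 ⟨_, hzA⟩
      have h5 : 0 < (S.filter (adj z)).card :=
        Finset.card_pos.2 ⟨y, Finset.mem_filter.2 ⟨hyS, hzy.1⟩⟩
      omega
    obtain ⟨Y, hYC, hYadj⟩ := hY
    rw [Finset.mem_sdiff] at hYC
    have hYne : ∀ a ∈ A, a ≠ Y := fun a ha e => hYC.2 (e ▸ ha)
    have hne := hnear Y hYC.1 (hYne _ hzA).symm hYadj
    refine ihN (c' Y) Y v hne ?_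
    have hold : ∀ i ∈ A, i ≠ c z → ReflTransGen (Movable adj S C (c' Y)) i v := by
      intro i hi hiz
      refine hreach Y i hi hiz ?_
      have h := hterm (c z) hzT i hi hiz
      clear hiz
      induction h using ReflTransGen.head_induction_on with
      | refl => exact .refl
      | @head a b hab hbv ih' =>
        have hbA : b ∈ A := (memA b).2 ⟨hab.1.2.1,
          ReflTransGen.mono (fun _ _ h => h.1) _ _ hbv⟩
        exact (ih' hbA).head ⟨hab, hYne b hbA⟩
    have hW : ReflTransGen (Movable adj S C (c' Y)) (c z) v := by
      rcases ((memA _).1 hzA).2.cases_head with h | ⟨b, hab, hbv⟩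
      · exact absurd h hzv
      · have hbA : b ∈ A := (memA b).2 ⟨hab.2.1, hbv⟩
        have hbz := hab.2.2.1.symm
        refine (hold b hbA hbz).head (hmove Y _ b hzA hbA hbz (hYne b hbA) ?_ hbz.symm)
        obtain ⟨x, hx, hxa, hxb⟩ := hab.2.2.2
        refine ⟨x, hx, ?_, hxa, hxb⟩
        rintro rfl
        obtain ⟨x', hx', hxb', hadj⟩ := hcase b hbA hbz
        exact hxb x' hx' hxb' hadj
    have hy₂z : y₂ ≠ z := fun e => hy₂A (e ▸ hzA)
    have hgy₂ := hgmem y₂ hy₂S hy₂y hy₂A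
    have hnew : ReflTransGen (Movable adj S C (c' Y)) (g y₂) v := by
      refine hW.head ⟨hgy₂.1, hAC hzA, fun e => hgy₂.2 (e ▸ hzA), y₂, hy₂S, ?_, ?_⟩
      · rw [hc'o Y y₂ hy₂y hy₂z]; exact if_neg hy₂A
      · intro x hx hxz hadj
        by_cases hxy : x = y
        · rw [hxy] at hadj; exact hyy₂ (hs _ _ hadj)
        by_cases hxz' : x = z
        · rw [hxz', hc'z] at hxz; exact hYne _ hzA hxz.symm
        rw [hc'o Y x hxy hxz'] at hxz
        exact hxz' (hzy₂.2 x hx ((hc₀A x hx hxy _ hzA).1 hxz) hadj)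
    have hlt : (C.filter fun i => ¬ ReflTransGen (Movable adj S C (c' Y)) i v) ⊂
        C.filter fun i => ¬ ReflTransGen (Movable adj S C c) i v := by
      refine (Finset.ssubset_iff_of_subset fun i hi => ?_).2 ⟨g y₂, ?_, ?_⟩
      · rw [Finset.mem_filter] at hi ⊢
        refine ⟨hi.1, fun h => hi.2 ?_⟩
        by_cases hiz : i = c z
        · rw [hiz]; exact hW
        · exact hold i ((memA i).2 ⟨hi.1, h⟩) hiz
      · exact Finset.mem_filter.2 ⟨hgy₂.1, fun h => hgy₂.2 ((memA _).2 ⟨hgy₂.1, h⟩)⟩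
      · exact fun h => (Finset.mem_filter.1 h).2 hnew
    have := Finset.card_lt_card hlt
    omega

lemma exists_equal_partition [Nonempty ι] (C : Finset ι) (s : ℕ) :
    ∀ S : Finset V, S.card = C.card * s →
    ∃ c : V → ι, (∀ x ∈ S, c x ∈ C) ∧ ∀ l ∈ C, (S.filter fun y => c y = l).card = s := by
  induction C using Finset.induction_on with
  | empty =>
    intro S hS
    have : S = ∅ := by simpa using hS
    subst this
    exact ⟨fun _ => Classical.arbitrary ι, by simp, by simp⟩
  | insert a C ha ih =>
    intro S hS
    rw [Finset.card_insert_of_notMem ha, add_mul, one_mul] at hS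
    obtain ⟨R, hRS, hR⟩ := Finset.exists_subset_card_eq (s := S) (n := s) (by omega)
    obtain ⟨c, hc, hcard⟩ := ih (S \ R) (by rw [Finset.card_sdiff_of_subset hRS]; omega)
    refine ⟨fun x => if x ∈ R then a else c x, fun x hx => ?_, fun l hl => ?_⟩
    · by_cases h : x ∈ R
      · simp [h]
      · simp only [if_neg h]
        exact Finset.mem_insert_of_mem (hc x (Finset.mem_sdiff.2 ⟨hx, h⟩))
    · rcases Finset.mem_insert.1 hl with rfl | hl
      · rw [← hR]
        congr 1
        ext x
        rw [Finset.mem_filter]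
        constructor
        · rintro ⟨hx, h⟩
          by_contra hxR
          simp only [if_neg hxR] at h
          exact ha (h ▸ hc x (Finset.mem_sdiff.2 ⟨hx, hxR⟩))
        · exact fun hx => ⟨hRS hx, if_pos hx⟩
      · rw [← hcard l hl]
        congr 1
        ext x
        rw [Finset.mem_filter, Finset.mem_filter, Finset.mem_sdiff]
        constructor
        · rintro ⟨hx, h⟩
          by_cases hxR : x ∈ R
          · simp only [if_pos hxR] at h; exact absurd (h ▸ hl) ha
          · simp only [if_neg hxR] at h; exact ⟨⟨hx, hxR⟩, h⟩
        · rintro ⟨⟨hx, hxR⟩, h⟩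
          exact ⟨hx, by simp only [if_neg hxR]; exact h⟩

/-- **Hajnal–Szemerédi theorem**: a graph on `|C| * s` vertices with maximum degree less than
`|C|` has a proper colouring by `C` with all colour classes of size `s`. -/
theorem hasEquitableColouring_of_degree_lt [Nonempty ι] (s : ℕ) (N : ℕ) : ∀ (adj : V → V → Prop)
    (S : Finset V) (C : Finset ι), (∀ x y, adj x y → adj y x) → (∀ x, ¬ adj x x) →
    (S.filter fun x => ∃ y ∈ S, adj x y).card ≤ N → S.card = C.card * s →
    (∀ x ∈ S, (S.filter fun y => adj x y).card < C.card) →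
    HasEquitableColouring adj S C s := by
  induction N with
  | zero =>
    intro adj S C hs hirr hN hS hdeg
    obtain ⟨c, hc, hcard⟩ := exists_equal_partition C s S hS
    refine ⟨c, ⟨hc, fun x hx y hy hxy => ?_⟩, hcard⟩
    have hmem : x ∈ S.filter fun x => ∃ y ∈ S, adj x y :=
      Finset.mem_filter.2 ⟨hx, y, hy, hxy⟩
    rw [Finset.card_eq_zero.1 (Nat.le_zero.1 hN)] at hmem
    exact absurd hmem (Finset.notMem_empty _)
  | succ N ih =>
    intro adj S C hs hirr hN hS hdeg
    by_cases hne : ∃ u ∈ S, ∃ y ∈ S, adj u y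
    swap
    · refine ih adj S C hs hirr ?_ hS hdeg
      rw [Finset.filter_false_of_mem fun x hx h => hne ⟨x, hx, h⟩]
      simp
    obtain ⟨u, hu, y₀, hy₀, huy₀⟩ := hne
    have hlt : ∀ (adj' : V → V → Prop) (S' : Finset V) (u' : V), S' ⊆ S →
        (∀ x y, adj' x y → adj x y) → u' ∈ S → (∃ y ∈ S, adj u' y) →
        (u' ∈ S' → ∀ y ∈ S', ¬ adj' u' y) →
        (S'.filter fun x => ∃ y ∈ S', adj' x y).card ≤ N := by
      intro adj' S' u' hS' hadj hu' huy hiso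
      have hss : (S'.filter fun x => ∃ y ∈ S', adj' x y) ⊂
          S.filter fun x => ∃ y ∈ S, adj x y := by
        refine (Finset.ssubset_iff_of_subset fun x hx => ?_).2
          ⟨u', Finset.mem_filter.2 ⟨hu', huy⟩, fun h => ?_⟩
        · rw [Finset.mem_filter] at hx ⊢
          obtain ⟨hx, y, hy, hxy⟩ := hx
          exact ⟨hS' hx, y, hS' hy, hadj _ _ hxy⟩
        · rw [Finset.mem_filter] at h
          obtain ⟨h1, y, hy, hxy⟩ := h
          exact hiso h1 y hy hxy
      have := Finset.card_lt_card hss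
      omega
    obtain ⟨adj', hadj'⟩ : ∃ adj' : V → V → Prop,
        ∀ x y, adj' x y ↔ adj x y ∧ x ≠ u ∧ y ≠ u := ⟨_, fun _ _ => Iff.rfl⟩
    have hle : ∀ x y, adj' x y → adj x y := fun x y h => ((hadj' x y).1 h).1
    obtain ⟨c, hc, hcard⟩ := ih adj' S C
      (fun x y h => (hadj' y x).2 (((hadj' x y).1 h).imp (hs _ _) And.symm))
      (fun x h => hirr x (hle _ _ h))
      (hlt _ S u subset_rfl hle hu ⟨y₀, hy₀, huy₀⟩ fun _ y _ h => ((hadj' u y).1 h).2.1 rfl) hS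
      (fun x hx => lt_of_le_of_lt (Finset.card_le_card
        (Finset.monotone_filter_right S fun y _ => hle x y)) (hdeg x hx))
    obtain ⟨w, hwC, hw⟩ : ∃ w ∈ C, ∀ y ∈ S, c y = w → ¬ adj u y := by
      by_contra h
      push Not at h
      refine absurd (hdeg u hu) (not_lt.2 ?_)
      refine (card_le_card_filter_mem (P := S.filter fun y => adj u y) (c := c)
        fun i hi => ?_).trans (Finset.card_le_card (Finset.filter_subset _ _))
      obtain ⟨y, hy, h1, h2⟩ := h i hi
      exact ⟨y, Finset.mem_filter.2 ⟨hy, h2⟩, h1⟩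
    have hnear : IsNearlyEquitable adj S C s (Function.update c u w) w (c u) := by
      refine ⟨⟨fun x hx => ?_, fun x hx y hy hxy => ?_⟩, hwC, hc.mem u hu, fun l hl => ?_⟩
      · by_cases h : x = u
        · rw [h, Function.update_self]; exact hwC
        · rw [Function.update_of_ne h]; exact hc.mem x hx
      · by_cases h : x = u
        · rw [h] at hxy ⊢
          have h' : y ≠ u := by rintro rfl; exact hirr _ hxy
          rw [Function.update_self, Function.update_of_ne h']
          exact fun e => hw y hy e.symm hxy
        · by_cases h' : y = u
          · rw [h'] at hxy ⊢
            rw [Function.update_self, Function.update_of_ne h]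
            exact fun e => hw x hx e (hs _ _ hxy)
          · rw [Function.update_of_ne h, Function.update_of_ne h']
            exact hc.ne x hx y hy ((hadj' x y).2 ⟨hxy, h, h'⟩)
      · rw [card_filter_update c hu w l, hcard l hl]
    refine IsNearlyEquitable.exists_of_induction hs hdeg ?_ _ _ _ _ hnear le_rfl
    rintro B hBS D ⟨x, hx, hxB, hxy⟩ hB hdB
    exact ih adj B D hs hirr (hlt adj B x hBS (fun _ _ h => h) hx hxy fun h => absurd h hxB) hB hdB

lemma card_filter_image_perm {α : Type*} [Fintype α] (r : ℕ) (b : Finset α) (hb : b.card = r)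
    {e : Finset α} (he : e.card = r) :
    (Finset.univ.filter fun σ : Equiv.Perm α => b.image σ = e).card *
      (Fintype.card α).choose r = Fintype.card (Equiv.Perm α) := by
  have h1 : ∀ e' ∈ Finset.powersetCard r (Finset.univ : Finset α),
      (Finset.univ.filter fun σ : Equiv.Perm α => b.image σ = e').card =
      (Finset.univ.filter fun σ : Equiv.Perm α => b.image σ = e).card := by
    intro e' he'
    have hcard := (Finset.mem_powersetCard.1 he').2
    let τ : Equiv.Perm α := (Finset.equivOfCardEq (hcard.trans he.symm)).extendSubtype
    have hτ : e'.image τ = e := by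
      refine Finset.eq_of_subset_of_card_le (fun y hy => ?_) ?_
      · obtain ⟨x, hx, rfl⟩ := Finset.mem_image.1 hy
        exact Equiv.extendSubtype_mem _ x hx
      · rw [Finset.card_image_of_injective _ τ.injective, hcard, he]
    refine Finset.card_equiv (Equiv.mulLeft τ) fun σ => ?_
    simp only [Finset.mem_filter, Finset.mem_univ, true_and, Equiv.coe_mulLeft]
    rw [Equiv.Perm.coe_mul, ← Finset.image_image, ← hτ]
    exact (Finset.image_injective τ.injective).eq_iff.symm
  have h2 := Finset.card_eq_sum_card_fiberwise (f := fun σ : Equiv.Perm α => b.image σ)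
    (s := Finset.univ) (t := Finset.powersetCard r (Finset.univ : Finset α)) (fun σ _ =>
      Finset.mem_coe.2 (Finset.mem_powersetCard.2 ⟨Finset.subset_univ _,
        (Finset.card_image_of_injective _ σ.injective).trans hb⟩))
  rw [Finset.sum_congr rfl h1, Finset.sum_const, Finset.card_powersetCard, smul_eq_mul,
    Finset.card_univ, Finset.card_univ] at h2
  rw [h2, mul_comm]

/-- An `r`-graph whose matchings have at most `k` edges contains at most a proportion `k / m` of
all `r`-sets when `m` disjoint `r`-sets fit in the vertex set. -/
lemma card_mul_le_of_matching_le {α : Type*} [Fintype α] {r m k : ℕ} (hr : 1 ≤ r)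
    (hm : m * r ≤ Fintype.card α) (R : Finset (Finset α)) (hR : ∀ e ∈ R, e.card = r)
    (hk : ∀ p ⊆ R, (∀ e ∈ p, ∀ f ∈ p, e ≠ f → Disjoint e f) → p.card ≤ k) :
    R.card * m ≤ k * (Fintype.card α).choose r := by
  obtain ⟨S, -, hS⟩ := Finset.exists_subset_card_eq (s := (Finset.univ : Finset α)) (n := m * r)
    (by rwa [Finset.card_univ])
  obtain ⟨c, -, hc⟩ := exists_equal_partition (Finset.range m) r S
    (by rw [Finset.card_range, hS])
  let b : ℕ → Finset α := fun i => S.filter fun x => c x = i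
  have hσ : ∀ σ : Equiv.Perm α,
      ((Finset.range m).filter fun i => (b i).image σ ∈ R).card ≤ k := by
    intro σ
    have hdisj : ∀ i j, i ≠ j → Disjoint ((b i).image σ) ((b j).image σ) := by
      intro i j hij
      rw [Finset.disjoint_image σ.injective, Finset.disjoint_left]
      intro x hx hx'
      exact hij ((Finset.mem_filter.1 hx).2.symm.trans (Finset.mem_filter.1 hx').2)
    rw [← Finset.card_image_of_injOn (f := fun i => (b i).image σ)]
    · refine hk _ (fun e he => ?_) fun e he f hf hef => ?_
      · obtain ⟨i, hi, rfl⟩ := Finset.mem_image.1 he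
        exact (Finset.mem_filter.1 hi).2
      · obtain ⟨i, hi, rfl⟩ := Finset.mem_image.1 he
        obtain ⟨j, hj, rfl⟩ := Finset.mem_image.1 hf
        exact hdisj i j fun e => hef (by rw [e])
    · intro i hi j hj hij
      by_contra hne
      have h1 := hdisj i j hne
      simp only at hij
      rw [← hij, disjoint_self, Finset.bot_eq_empty] at h1
      have h2 := hR _ (Finset.mem_filter.1 (Finset.mem_coe.1 hi)).2
      rw [h1, Finset.card_empty] at h2
      omega
  have h1 : ∑ σ : Equiv.Perm α, ((Finset.range m).filter fun i => (b i).image σ ∈ R).card =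
      ∑ i ∈ Finset.range m, ∑ e ∈ R,
        (Finset.univ.filter fun σ : Equiv.Perm α => (b i).image σ = e).card := by
    simp only [Finset.card_filter]
    rw [Finset.sum_comm]
    refine Finset.sum_congr rfl fun i _ => ?_
    rw [Finset.sum_comm]
    refine Finset.sum_congr rfl fun σ _ => ?_
    rw [Finset.sum_ite_eq]
  have h2 := Finset.sum_le_card_nsmul (Finset.univ : Finset (Equiv.Perm α)) _ _ fun σ _ => hσ σ
  rw [h1, smul_eq_mul, Finset.card_univ] at h2
  have h3 := Nat.mul_le_mul_right ((Fintype.card α).choose r) h2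
  have h4 : ∀ i ∈ Finset.range m,
      (∑ e ∈ R, (Finset.univ.filter fun σ : Equiv.Perm α => (b i).image σ = e).card) *
        (Fintype.card α).choose r = R.card * Fintype.card (Equiv.Perm α) := by
    intro i hi
    have hbi : (b i).card = r := by convert hc i hi
    rw [Finset.sum_mul, Finset.sum_congr rfl fun e he =>
      card_filter_image_perm r (b i) hbi (hR e he), Finset.sum_const, smul_eq_mul]
  rw [Finset.sum_mul, Finset.sum_congr rfl h4, Finset.sum_const, Finset.card_range,
    smul_eq_mul] at h3
  have hpos : 0 < Fintype.card (Equiv.Perm α) := Fintype.card_pos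
  refine Nat.le_of_mul_le_mul_left (le_trans (le_of_eq ?_) (h3.trans (le_of_eq ?_))) hpos <;> ring

end EquitableColouring

section MatchingDecomposition

open scoped Classical

variable {n : ℕ}

lemma phiM_add_le {k : ℕ} {G : Finset (Finset (Fin n))}
    (F : Finset (Finset (Finset (Fin n)))) (hF : ∀ p ∈ F, IsMatchingSet k p ∧ p ⊆ G)
    (hd : ∀ p ∈ F, ∀ q ∈ F, p ≠ q → Disjoint p q) :
    phiM k G ≤ F.card + (G \ F.biUnion id).card ∧
      (G \ F.biUnion id).card + k * F.card = G.card := by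
  have hFG : F.biUnion id ⊆ G := Finset.biUnion_subset.2 fun p hp => (hF p hp).2
  constructor
  · suffices hdec : IsMatchingDecomp k G (F ∪ (G \ F.biUnion id).image fun e => {e}) from
      le_trans (b := (F ∪ (G \ F.biUnion id).image fun e => {e}).card)
        (Nat.sInf_le (s := {m | ∃ P, IsMatchingDecomp k G P ∧ P.card = m}) ⟨_, hdec, rfl⟩)
        ((Finset.card_union_le _ _).trans (Nat.add_le_add_left Finset.card_image_le _))
    refine ⟨?_, ?_, ?_⟩
    · have hFs : ∀ p ∈ F, ∀ e ∈ G \ F.biUnion id, Disjoint p {e} := by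
        intro p hp e he
        rw [Finset.disjoint_singleton_right]
        exact fun h => (Finset.mem_sdiff.1 he).2 (Finset.mem_biUnion.2 ⟨p, hp, h⟩)
      intro p hp q hq hpq
      rcases Finset.mem_union.1 hp with hp | hp <;> rcases Finset.mem_union.1 hq with hq | hq
      · exact hd p hp q hq hpq
      · obtain ⟨e, he, rfl⟩ := Finset.mem_image.1 hq
        exact hFs p hp e he
      · obtain ⟨e, he, rfl⟩ := Finset.mem_image.1 hp
        exact (hFs q hq e he).symm
      · obtain ⟨e, he, rfl⟩ := Finset.mem_image.1 hp
        obtain ⟨f, hf, rfl⟩ := Finset.mem_image.1 hq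
        rw [Finset.disjoint_singleton]
        exact fun h => hpq (by rw [h])
    · ext e
      simp only [Finset.mem_biUnion, Finset.mem_union, Finset.mem_image, id]
      constructor
      · rintro ⟨p, hp | ⟨f, hf, rfl⟩, he⟩
        · exact (hF p hp).2 he
        · rw [Finset.mem_singleton.1 he]; exact (Finset.mem_sdiff.1 hf).1
      · intro he
        by_cases h : e ∈ F.biUnion id
        · obtain ⟨p, hp, hep⟩ := Finset.mem_biUnion.1 h
          exact ⟨p, Or.inl hp, hep⟩
        · exact ⟨{e}, Or.inr ⟨e, Finset.mem_sdiff.2 ⟨he, h⟩, rfl⟩, Finset.mem_singleton_self e⟩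
    · intro p hp
      rcases Finset.mem_union.1 hp with hp | hp
      · exact Or.inr (hF p hp).1
      · obtain ⟨e, -, rfl⟩ := Finset.mem_image.1 hp
        exact Or.inl ⟨e, rfl⟩
  · have h1 : (F.biUnion id).card = k * F.card := by
      rw [Finset.card_biUnion (s := F) (t := id) (fun p hp q hq hpq => hd p hp q hq hpq)]
      exact (Finset.sum_const_nat fun p hp => (hF p hp).1.1).trans (mul_comm _ _)
    rw [← h1]
    exact Finset.card_sdiff_add_card_eq_card hFG

lemma div_add_mod_le_phiM {k : ℕ} (hk : 1 ≤ k) (G : Finset (Finset (Fin n))) :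
    G.card / k + G.card % k ≤ phiM k G := by
  have hne : {m | ∃ P, IsMatchingDecomp k G P ∧ P.card = m}.Nonempty := by
    refine ⟨_, G.image fun e => {e}, ⟨?_, ?_, ?_⟩, rfl⟩
    · intro p hp q hq hpq
      obtain ⟨e, he, rfl⟩ := Finset.mem_image.1 hp
      obtain ⟨f, hf, rfl⟩ := Finset.mem_image.1 hq
      rw [Finset.disjoint_singleton]
      exact fun h => hpq (by rw [h])
    · ext e
      simp
    · intro p hp
      obtain ⟨e, -, rfl⟩ := Finset.mem_image.1 hp
      exact Or.inl ⟨e, rfl⟩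
  obtain ⟨P, ⟨hd, hU, hP⟩, hcard⟩ := Nat.sInf_mem hne
  change P.card = phiM k G at hcard
  rw [← hcard]
  have h1 : G.card = ∑ p ∈ P, p.card := by
    rw [← hU]
    convert Finset.card_biUnion (s := P) (t := id) fun p hp q hq hpq => hd p hp q hq hpq
    rfl
  have hcases : ∀ p ∈ P, p.card = 1 + (if p.card = k then k - 1 else 0) := by
    intro p hp
    rcases hP p hp with ⟨e, rfl⟩ | h
    · rw [Finset.card_singleton]
      split_ifs <;> omega
    · rw [if_pos h.1, h.1]; omega
  set a := (P.filter fun p => p.card = k).card with ha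
  have h2 : G.card = P.card + a * (k - 1) := by
    rw [h1, Finset.sum_congr rfl hcases, Finset.sum_add_distrib, Finset.sum_const, smul_eq_mul,
      mul_one, ← Finset.sum_filter, Finset.sum_const, smul_eq_mul]
  have h3 : a ≤ P.card := Finset.card_filter_le _ _
  have h4 : a ≤ G.card / k := by
    rw [Nat.le_div_iff_mul_le hk]
    calc a * k = a + a * (k - 1) := by
          obtain ⟨j, rfl⟩ := Nat.exists_eq_add_of_le hk
          rw [Nat.add_sub_cancel_left]; ring
      _ ≤ G.card := by omega
  have h5 := Nat.div_add_mod G.card k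
  have h6 : a * (k - 1) ≤ G.card / k * (k - 1) := Nat.mul_le_mul_right _ h4
  have h7 : k * (G.card / k) = G.card / k + G.card / k * (k - 1) := by
    obtain ⟨j, hj⟩ := Nat.exists_eq_add_of_le hk
    have : k - 1 = j := by omega
    rw [this]
    nth_rewrite 1 [hj]
    ring
  omega

lemma card_filter_mem_powersetCard {r : ℕ} (x : Fin n) :
    ((Finset.powersetCard r (Finset.univ : Finset (Fin n))).filter fun e => x ∈ e).card ≤
      (n - 1).choose (r - 1) := by
  have h1 : (Finset.powersetCard (r - 1) (Finset.univ.erase x)).card = (n - 1).choose (r - 1) := by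
    rw [Finset.card_powersetCard, Finset.card_erase_of_mem (Finset.mem_univ x), Finset.card_univ,
      Fintype.card_fin]
  rw [← h1]
  refine Finset.card_le_card_of_injOn (fun e => e.erase x) (fun e he => ?_) fun e he f hf hef => ?_
  · have he' := Finset.mem_filter.1 (Finset.mem_coe.1 he)
    refine Finset.mem_coe.2 (Finset.mem_powersetCard.2
      ⟨Finset.erase_subset_erase _ (Finset.subset_univ _), ?_⟩)
    rw [Finset.card_erase_of_mem he'.2, (Finset.mem_powersetCard.1 he'.1).2]
  · have he' := Finset.mem_filter.1 (Finset.mem_coe.1 he)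
    have hf' := Finset.mem_filter.1 (Finset.mem_coe.1 hf)
    simp only at hef
    rw [← Finset.insert_erase he'.2, hef, Finset.insert_erase hf'.2]

/-- A dense `r`-graph can be decomposed into matchings of size `k` and fewer than `k` edges. -/
lemma phiM_le_of_card_le {k r D : ℕ} (hk : 1 ≤ k)
    (hD : (n - 1).choose (r - 1) = D + 1) {G : Finset (Finset (Fin n))}
    (hG : ∀ e ∈ G, e.card = r) (hcard : k * (r * D + 1) ≤ G.card) :
    phiM k G ≤ G.card / k + G.card % k := by
  set q := G.card / k with hq
  have hdm := Nat.div_add_mod G.card k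
  obtain ⟨S, hSG, hS⟩ := Finset.exists_subset_card_eq (s := G) (n := q * k)
    (Nat.div_mul_le_self _ _)
  have hq1 : r * D + 1 ≤ q := by
    rw [hq, Nat.le_div_iff_mul_le hk, mul_comm]; exact hcard
  obtain ⟨adj, hadj⟩ : ∃ adj : Finset (Fin n) → Finset (Fin n) → Prop,
      ∀ e f, adj e f ↔ e ≠ f ∧ ¬ Disjoint e f := ⟨_, fun _ _ => Iff.rfl⟩
  obtain ⟨c, hc, hccard'⟩ := hasEquitableColouring_of_degree_lt k _ adj S (Finset.range q)
    (fun e f h => by rw [hadj] at h ⊢; exact ⟨h.1.symm, fun h' => h.2 h'.symm⟩)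
    (fun e h => ((hadj e e).1 h).1 rfl) le_rfl
    (by rw [Finset.card_range, hS]) (by
      intro e he
      rw [Finset.card_range]
      refine lt_of_lt_of_le (Nat.lt_succ_of_le ?_) hq1
      refine (Finset.card_le_card (t := e.biUnion fun x =>
        ((Finset.powersetCard r (Finset.univ : Finset (Fin n))).filter
          fun f => x ∈ f).erase e) fun f hf => ?_).trans ?_
      · obtain ⟨hfS, hef⟩ := Finset.mem_filter.1 hf
        obtain ⟨hne, hnd⟩ := (hadj e f).1 hef
        obtain ⟨x, hxe, hxf⟩ := Finset.not_disjoint_iff.1 hnd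
        exact Finset.mem_biUnion.2 ⟨x, hxe, Finset.mem_erase.2 ⟨hne.symm, Finset.mem_filter.2
          ⟨Finset.mem_powersetCard.2 ⟨Finset.subset_univ _, hG f (hSG hfS)⟩, hxf⟩⟩⟩
      · rw [← hG e (hSG he)]
        refine Finset.card_biUnion_le_card_mul _ _ _ fun x hx => ?_
        rw [Finset.card_erase_of_mem (Finset.mem_filter.2
          ⟨Finset.mem_powersetCard.2 ⟨Finset.subset_univ _, rfl⟩, hx⟩), hG e (hSG he)]
        have := card_filter_mem_powersetCard (r := r) x
        omega)
  have hccard : ∀ i ∈ Finset.range q, (S.filter fun e => c e = i).card = k := fun i hi => by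
    convert hccard' i hi
  have hdisj : ∀ i j, i ≠ j → Disjoint (S.filter fun e => c e = i) (S.filter fun e => c e = j) := by
    intro i j hij
    rw [Finset.disjoint_left]
    intro x hx hx'
    exact hij ((Finset.mem_filter.1 hx).2.symm.trans (Finset.mem_filter.1 hx').2)
  obtain ⟨h1, h2⟩ := phiM_add_le (k := k) (G := G)
    ((Finset.range q).image fun i => S.filter fun e => c e = i) (by
      intro p hp
      obtain ⟨i, hi, rfl⟩ := Finset.mem_image.1 hp
      refine ⟨⟨hccard i hi, fun e he f hf hef => ?_⟩, (Finset.filter_subset _ _).trans hSG⟩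
      rw [Finset.mem_filter] at he hf
      by_contra h
      exact hc.ne e he.1 f hf.1 ((hadj e f).2 ⟨hef, h⟩) (he.2.trans hf.2.symm)) (by
      intro p hp p' hp' hne
      obtain ⟨i, hi, rfl⟩ := Finset.mem_image.1 hp
      obtain ⟨j, hj, rfl⟩ := Finset.mem_image.1 hp'
      exact hdisj i j fun e => hne (by rw [e]))
  have h3 : ((Finset.range q).image fun i => S.filter fun e => c e = i).card = q := by
    rw [Finset.card_image_of_injOn, Finset.card_range]
    intro i hi j hj hij
    by_contra hne
    have h3 := hdisj i j hne
    simp only at hij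
    rw [← hij, disjoint_self, Finset.bot_eq_empty] at h3
    have h4 := hccard i hi
    rw [h3, Finset.card_empty] at h4
    omega
  rw [h3] at h1 h2
  rw [← hq] at hdm
  omega

/-- Removing matchings of size `k` greedily leaves few edges. -/
lemma exists_phiM_le {k r m : ℕ} (hk : 1 ≤ k) (hr : 1 ≤ r) (hm : m * r ≤ n)
    {G : Finset (Finset (Fin n))} (hG : ∀ e ∈ G, e.card = r) :
    ∃ R : ℕ, R * m ≤ (k - 1) * n.choose r ∧ k * phiM k G ≤ G.card + (k - 1) * R := by
  let fam := G.powerset.powerset.filter fun F : Finset (Finset (Finset (Fin n))) =>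
    (∀ p ∈ F, IsMatchingSet k p) ∧ ∀ p ∈ F, ∀ q ∈ F, p ≠ q → Disjoint p q
  obtain ⟨F, hF, hmax⟩ := Finset.exists_max_image fam Finset.card
    ⟨∅, Finset.mem_filter.2 ⟨by simp, by simp⟩⟩
  obtain ⟨hFG, hFm, hFd⟩ := Finset.mem_filter.1 hF
  rw [Finset.mem_powerset] at hFG
  obtain ⟨h1, h2⟩ := phiM_add_le (k := k) (G := G) F
    (fun p hp => ⟨hFm p hp, Finset.mem_powerset.1 (hFG hp)⟩) hFd
  refine ⟨(G \ F.biUnion id).card, ?_, ?_⟩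
  · have := card_mul_le_of_matching_le (α := Fin n) (m := m) (k := k - 1) hr
      (by rwa [Fintype.card_fin]) (G \ F.biUnion id)
      (fun e he => hG e (Finset.mem_sdiff.1 he).1) (by
        intro p hp hpd
        by_contra hlt
        obtain ⟨p', hp', hcard⟩ := Finset.exists_subset_card_eq (s := p) (n := k) (by omega)
        have hdis : ∀ q ∈ F, Disjoint p' q := fun q hq => Finset.disjoint_left.2 fun e he heq =>
          (Finset.mem_sdiff.1 (hp (hp' he))).2 (Finset.mem_biUnion.2 ⟨q, hq, heq⟩)
        have hp'F : p' ∉ F := by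
          intro h
          have := hdis p' h
          rw [disjoint_self, Finset.bot_eq_empty] at this
          rw [this, Finset.card_empty] at hcard
          omega
        have hmem : insert p' F ∈ fam := by
          refine Finset.mem_filter.2 ⟨Finset.mem_powerset.2 (Finset.insert_subset
            (Finset.mem_powerset.2 fun e he => (Finset.mem_sdiff.1 (hp (hp' he))).1) hFG),
            fun q hq => ?_, fun q hq q' hq' hne => ?_⟩
          · rcases Finset.mem_insert.1 hq with rfl | hq
            · exact ⟨hcard, fun e he f hf => hpd e (hp' he) f (hp' hf)⟩
            · exact hFm q hq
          · rcases Finset.mem_insert.1 hq with h | hq <;>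
              rcases Finset.mem_insert.1 hq' with h' | hq'
            · exact absurd (h.trans h'.symm) hne
            · rw [h]; exact hdis q' hq'
            · rw [h']; exact (hdis q hq).symm
            · exact hFd q hq q' hq' hne
        have := hmax _ hmem
        rw [Finset.card_insert_of_notMem hp'F] at this
        omega)
    rwa [Fintype.card_fin] at this
  · rw [← h2]
    obtain ⟨j, rfl⟩ := Nat.exists_eq_add_of_le hk
    rw [Nat.add_sub_cancel_left]
    refine (Nat.mul_le_mul_left _ h1).trans (le_of_eq ?_)
    ring

lemma mul_choose_pred_le {r m : ℕ} (hr : 1 ≤ r) (hm : m * r ≤ n) (hn : 1 ≤ n) :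
    m * (n - 1).choose (r - 1) ≤ n.choose r := by
  obtain ⟨n, rfl⟩ := Nat.exists_eq_add_of_le' hn
  obtain ⟨r, rfl⟩ := Nat.exists_eq_add_of_le' hr
  have h := Nat.add_one_mul_choose_eq n r
  have h2 := Nat.mul_le_mul_right (n.choose r) hm
  rw [Nat.add_sub_cancel, Nat.add_sub_cancel]
  refine Nat.le_of_mul_le_mul_right ?_ (show 0 < r + 1 by omega)
  rw [← h]
  exact le_trans (le_of_eq (by ring)) h2

lemma phiM_le_or_mul_lt {k r : ℕ} (hk : 1 ≤ k) (hr : 2 ≤ r)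
    (hn : k * r * (k + r - 2) + 2 * r - 1 ≤ n) {G : Finset (Finset (Fin n))}
    (hG : ∀ e ∈ G, e.card = r) :
    phiM k G ≤ G.card / k + G.card % k ∨ k * phiM k G < n.choose r := by
  obtain ⟨m, hm, hmr⟩ : ∃ m, m = (k - 1) ^ 2 + k * r ∧ m * r ≤ n := by
    refine ⟨_, rfl, ?_⟩
    obtain ⟨k, rfl⟩ := Nat.exists_eq_add_of_le' hk
    obtain ⟨r, rfl⟩ := Nat.exists_eq_add_of_le' hr
    rw [show k + 1 + (r + 2) - 2 = k + r + 1 by omega] at hn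
    rw [Nat.add_sub_cancel]
    have : (k ^ 2 + (k + 1) * (r + 2)) * (r + 2) =
        (k + 1) * (r + 2) * (k + r + 1) + (r + 2) := by ring
    omega
  have hmpos : 0 < m := by
    have : 0 < k * r := Nat.mul_pos hk (by omega)
    omega
  have hrn : r ≤ n := le_trans (Nat.le_mul_of_pos_left r hmpos) hmr
  obtain ⟨D, hD⟩ := Nat.exists_eq_add_of_le' (Nat.choose_pos (Nat.sub_le_sub_right hrn 1))
  rcases le_or_gt (k * (r * D + 1)) G.card with h | h
  · exact Or.inl (phiM_le_of_card_le hk hD hG h)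
  refine Or.inr ?_
  obtain ⟨R, hR, hphi⟩ := exists_phiM_le hk (by omega) hmr hG
  have hmD := mul_choose_pred_le (n := n) (r := r) (by omega) hmr (by omega)
  rw [hD] at hmD
  have h1 : G.card < k * r * (D + 1) := by nlinarith
  refine Nat.lt_of_mul_lt_mul_left (a := m) ?_
  calc m * (k * phiM k G) ≤ m * G.card + (k - 1) * (R * m) := by
        refine (Nat.mul_le_mul_left m hphi).trans (le_of_eq ?_)
        ring
    _ < m * (k * r * (D + 1)) + (k - 1) * ((k - 1) * n.choose r) :=
        Nat.add_lt_add_of_lt_of_le (Nat.mul_lt_mul_of_pos_left h1 hmpos)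
          (Nat.mul_le_mul_left _ hR)
    _ = k * r * (m * (D + 1)) + (k - 1) ^ 2 * n.choose r := by ring
    _ ≤ k * r * n.choose r + (k - 1) ^ 2 * n.choose r :=
        Nat.add_le_add_right (Nat.mul_le_mul_left _ hmD) _
    _ = m * n.choose r := by rw [hm]; ring

end MatchingDecomposition

lemma div_add_mod_le_iff {k Q ℓ a : ℕ} (hk : 1 ≤ k) (hℓ : ℓ ≤ k - 1)
    (ha : a ≤ k * Q + (k - 1) + ℓ) :
    a / k + a % k ≤ Q + (k - 1) ∧
      (a / k + a % k = Q + (k - 1) ↔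
        a = k * Q + (k - 1) ∨ (a = k * Q + (k - 1) + ℓ ∧ ℓ = k - 1)) := by
  have h1 := Nat.div_add_mod a k
  have h2 := Nat.mod_lt a hk
  generalize a / k = q at *
  generalize a % k = s at *
  rcases lt_trichotomy q Q with h | h | h
  · have := Nat.mul_le_mul_left k (show q + 1 ≤ Q from h)
    rw [mul_add] at this
    omega
  · subst h
    omega
  · obtain ⟨d, rfl⟩ := Nat.exists_eq_add_of_le (show Q + 1 ≤ q from h)
    rcases Nat.eq_zero_or_pos d with rfl | hd
    · rw [add_zero, mul_add, mul_one] at h1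
      omega
    · have := Nat.mul_le_mul_left k (show Q + 2 ≤ Q + 1 + d by omega)
      rw [mul_add] at this
      omega

/-- Extremal graphs: for `k ≥ 1`, `r ≥ 2`, `n ≥ kr(k+r-2) + 2r - 1` and `H` the `r`-graph
consisting of exactly `k` pairwise disjoint edges, an `r`-graph `G` on `n` vertices
satisfies `φ_H^r(G) = φ_H^r(n)` if and only if either `G` is obtained from the complete
`r`-graph `K_n^r` by deleting exactly `ℓ` edges, where `0 ≤ ℓ ≤ k - 1` and
`C(n,r) - ℓ ≡ k - 1 (mod k)`, or `G = K_n^r` and `C(n,r) ≡ k - 2 (mod k)`. -/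
theorem extremal_iff (k r n : ℕ) (hk : 1 ≤ k) (hr : 2 ≤ r)
    (hn : k * r * (k + r - 2) + 2 * r - 1 ≤ n)
    (G : Finset (Finset (Fin n))) (hG : ∀ e ∈ G, e.card = r) :
    phiM k G = phiMMax r k n ↔
      ((∃ ℓ : ℕ, ℓ ≤ k - 1 ∧ (n.choose r - ℓ) % k = k - 1 ∧
          G ⊆ Finset.powersetCard r (Finset.univ : Finset (Fin n)) ∧
          G.card = n.choose r - ℓ) ∨
        (G = Finset.powersetCard r (Finset.univ : Finset (Fin n)) ∧
          n.choose r % k = k - 2)) := by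
  have hsub : ∀ G' : Finset (Finset (Fin n)), (∀ e ∈ G', e.card = r) →
      G' ⊆ Finset.powersetCard r (Finset.univ : Finset (Fin n)) := fun G' h e he =>
    Finset.mem_powersetCard.2 ⟨Finset.subset_univ _, h e he⟩
  have hcardK : (Finset.powersetCard r (Finset.univ : Finset (Fin n))).card = n.choose r := by
    rw [Finset.card_powersetCard, Finset.card_univ, Fintype.card_fin]
  have hle : ∀ G' : Finset (Finset (Fin n)), (∀ e ∈ G', e.card = r) → G'.card ≤ n.choose r :=
    fun G' h => hcardK ▸ Finset.card_le_card (hsub G' h)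
  have hkr : 2 * k ≤ k * r := by rw [mul_comm]; exact Nat.mul_le_mul_left k hr
  have hkn : k * r ≤ k * r * (k + r - 2) := Nat.le_mul_of_pos_right _ (by omega)
  have hkN : k ≤ n.choose r := by
    have h := mul_choose_pred_le (n := n) (r := r) (m := n / r) (by omega)
      (Nat.div_mul_le_self n r) (by omega)
    have h2 : 1 ≤ (n - 1).choose (r - 1) := Nat.choose_pos (by omega)
    have h3 : k ≤ n / r := (Nat.le_div_iff_mul_le (by omega)).2 (by omega)
    exact h3.trans ((Nat.le_mul_of_pos_right _ h2).trans h)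
  obtain ⟨Q, ℓ₀, hℓ₀, hN⟩ : ∃ Q ℓ₀, ℓ₀ ≤ k - 1 ∧ n.choose r = k * Q + (k - 1) + ℓ₀ := by
    refine ⟨(n.choose r + 1 - k) / k, (n.choose r + 1 - k) % k,
      Nat.le_sub_one_of_lt (Nat.mod_lt _ hk), ?_⟩
    have := Nat.div_add_mod (n.choose r + 1 - k) k
    omega
  have hbig : n.choose r ≤ k * (Q + (k - 1)) := by
    obtain ⟨j, rfl⟩ := Nat.exists_eq_add_of_le' hk
    rw [Nat.add_sub_cancel] at *
    have := Nat.le_mul_self j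
    nlinarith
  have hphi : ∀ G' : Finset (Finset (Fin n)), (∀ e ∈ G', e.card = r) →
      phiM k G' ≤ Q + (k - 1) ∧ (phiM k G' = Q + (k - 1) ↔
        G'.card / k + G'.card % k = Q + (k - 1)) := by
    intro G' hG'
    have h1 := div_add_mod_le_phiM hk G'
    have h2 := (div_add_mod_le_iff hk hℓ₀ (hN ▸ hle G' hG')).1
    rcases phiM_le_or_mul_lt hk hr hn hG' with h | h
    · omega
    · have := Nat.lt_of_mul_lt_mul_left (h.trans_le hbig)
      omega
  have hmax : phiMMax r k n = Q + (k - 1) := by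
    refine IsGreatest.csSup_eq ⟨?_, ?_⟩
    · obtain ⟨G₀, hG₀, hG₀card⟩ := Finset.exists_subset_card_eq
        (s := Finset.powersetCard r (Finset.univ : Finset (Fin n))) (n := k * Q + (k - 1))
        (by omega)
      have hG₀r : ∀ e ∈ G₀, e.card = r := fun e he => (Finset.mem_powersetCard.1 (hG₀ he)).2
      exact ⟨G₀, hG₀r, (hphi G₀ hG₀r).2.2
        ((div_add_mod_le_iff hk hℓ₀ (hN ▸ hle G₀ hG₀r)).2.2 (Or.inl hG₀card))⟩
    · rintro m ⟨G', hG', rfl⟩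
      exact (hphi G' hG').1
  rw [hmax, (hphi G hG).2, (div_add_mod_le_iff hk hℓ₀ (hN ▸ hle G hG)).2, hN]
  have hmod : ∀ a, (k * Q + a) % k = a % k := fun a => by rw [Nat.mul_add_mod]
  constructor
  · rintro (h | ⟨h, h'⟩)
    · refine Or.inl ⟨ℓ₀, hℓ₀, ?_, hsub G hG, by omega⟩
      rw [Nat.add_sub_cancel, hmod, Nat.mod_eq_of_lt (by omega)]
    · rcases Nat.lt_or_ge k 2 with h1 | h2
      · refine Or.inl ⟨ℓ₀, hℓ₀, ?_, hsub G hG, by omega⟩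
        rw [Nat.add_sub_cancel, hmod, Nat.mod_eq_of_lt (by omega)]
      · refine Or.inr ⟨Finset.eq_of_subset_of_card_le (hsub G hG) (by omega), ?_⟩
        rw [show k * Q + (k - 1) + ℓ₀ = k * Q + (k - 2 + k) by omega, hmod, Nat.add_mod_right,
          Nat.mod_eq_of_lt (by omega)]
  · rintro (⟨ℓ, hℓ, hmodℓ, -, hcard⟩ | ⟨h, hmodN⟩)
    · left
      have hℓeq : ℓ = ℓ₀ := by
        rw [show k * Q + (k - 1) + ℓ₀ - ℓ = k * Q + (k - 1 + ℓ₀ - ℓ) by omega, hmod] at hmodℓ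
        rcases Nat.lt_or_ge (k - 1 + ℓ₀ - ℓ) k with h1 | h1
        · rw [Nat.mod_eq_of_lt h1] at hmodℓ
          omega
        · rw [Nat.mod_eq_sub_mod h1, Nat.mod_eq_of_lt (by omega)] at hmodℓ
          omega
      omega
    · rw [add_assoc, hmod] at hmodN
      rw [h, hcardK, hN]
      rcases Nat.lt_or_ge (k - 1 + ℓ₀) k with h1 | h1
      · rw [Nat.mod_eq_of_lt h1] at hmodN
        omega
      · rw [Nat.mod_eq_sub_mod h1, Nat.mod_eq_of_lt (by omega)] at hmodN
        omega
end

section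
/- Let k ≥ 1 and r ≥ 2 be integers, n ≥ kr(k+r−2) + 2r − 1, and let H be the r-uniform hypergraph consisting of exactly k pairwise disjoint edges. Let ℓ be the unique integer with 0 ≤ ℓ ≤ k−1 and C(n,r) − ℓ ≡ k−1 (mod k), and let G be any r-graph obtained from the complete r-graph K_n^r by deleting ℓ edges. Then φ_H^r(G) = (C(n,r) − ℓ − (k−1))/k + (k−1). -/
open scoped Finset

theorem exists_injective_of_weights {A J : Type*} [Fintype A] [Fintype J] [DecidableEq J]
    (w : A → J → ℚ) (h0 : ∀ a j, 0 ≤ w a j) (hA : ∀ a, ∑ j, w a j = 1)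
    (hJ : ∀ j, ∑ a, w a j ≤ 1) :
    ∃ g : A → J, Function.Injective g ∧ (∀ a, w a (g a) ≠ 0) ∧
      ∀ j, ∑ a, w a j = 1 → ∃ a, g a = j := by
  classical
  have hsum : ∑ j, ∑ a, w a j = Fintype.card A := by
    rw [Finset.sum_comm]; simp [hA]
  have hcard : Fintype.card A ≤ Fintype.card J := by
    have : (Fintype.card A : ℚ) ≤ Fintype.card J := by
      rw [← hsum]
      calc _ ≤ ∑ j : J, (1 : ℚ) := Finset.sum_le_sum fun j _ => hJ j
        _ = _ := by simp
    exact_mod_cast this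
  obtain ⟨d, hd⟩ := Nat.exists_eq_add_of_le hcard
  let w' : A ⊕ Fin d → J → ℚ := Sum.elim w fun _ j => (1 - ∑ a, w a j) / d
  have h0' : ∀ a j, 0 ≤ w' a j := by
    rintro (a | a) j
    · exact h0 a j
    · exact div_nonneg (sub_nonneg.2 (hJ j)) (Nat.cast_nonneg d)
  have hA' : ∀ a, ∑ j, w' a j = 1 := by
    rintro (a | a)
    · exact hA a
    · have hd0 : (d : ℚ) ≠ 0 := by exact_mod_cast (Fin.pos a).ne'
      simp only [w', Sum.elim_inr]
      rw [← Finset.sum_div, Finset.sum_sub_distrib, hsum, div_eq_one_iff_eq hd0]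
      simp [hd]
  have hJ' : ∀ j, ∑ a, w' a j ≤ 1 := by
    intro j
    rw [Fintype.sum_sum_type]
    simp only [w', Sum.elim_inr, Sum.elim_inl, Finset.sum_const, Finset.card_univ,
      Fintype.card_fin, nsmul_eq_mul]
    rcases eq_or_ne (d : ℚ) 0 with h | h
    · simpa [h] using hJ j
    · rw [mul_div_cancel₀ _ h]; linarith
  obtain ⟨g, hg, hgw⟩ := (Finset.all_card_le_biUnion_card_iff_exists_injective
    (fun a => Finset.univ.filter fun j => w' a j ≠ 0)).1 (by
      intro s
      set N := s.biUnion fun a => Finset.univ.filter fun j => w' a j ≠ 0 with hN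
      have : (s.card : ℚ) ≤ N.card := by
        calc (s.card : ℚ) = ∑ a ∈ s, ∑ j, w' a j := by simp [hA']
          _ = ∑ a ∈ s, ∑ j ∈ N, w' a j := by
            refine Finset.sum_congr rfl fun a ha => ?_
            refine (Finset.sum_subset (Finset.subset_univ _) fun j _ hj => ?_).symm
            by_contra hne
            exact hj (Finset.mem_biUnion.2 ⟨a, ha, by simpa using hne⟩)
          _ = ∑ j ∈ N, ∑ a ∈ s, w' a j := Finset.sum_comm
          _ ≤ ∑ j ∈ N, ∑ a, w' a j := Finset.sum_le_sum fun j _ =>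
            Finset.sum_le_sum_of_subset_of_nonneg (Finset.subset_univ _) fun a _ _ => h0' a j
          _ ≤ ∑ j ∈ N, 1 := Finset.sum_le_sum fun j _ => hJ' j
          _ = N.card := by simp
      exact_mod_cast this)
  have hgb : Function.Bijective g :=
    (Fintype.bijective_iff_injective_and_card g).2 ⟨hg, by simp [hd]⟩
  refine ⟨g ∘ Sum.inl, hg.comp Sum.inl_injective, fun a => ?_, fun j hj => ?_⟩
  · exact (Finset.mem_filter.1 (hgw (Sum.inl a))).2
  · obtain ⟨a | a, ha⟩ := hgb.2 j
    · exact ⟨a, ha⟩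
    · have := hgw (Sum.inr a)
      simp [w', ha, hj] at this

theorem exists_perm_extending {E T : Type*} [Finite E] (t : E → T) (p : E → Prop)
    (h : {e // p e} → E) (hinj : Function.Injective h) (ht : ∀ e, t (h e) = t e) :
    ∃ σ : Equiv.Perm E, (∀ e, t (σ e) = t e) ∧ ∀ e : {e // p e}, σ e = h e := by
  classical
  have key : ∀ x, ∃ τ : Equiv.Perm {e // t e = x},
      ∀ e : {e // p e}, ∀ hx : t e = x, (τ ⟨e, hx⟩ : E) = h e := by
    intro x
    let q : {e // t e = x} → Prop := fun e => p e
    let h' : {e : {e // t e = x} // q e} → {e // t e = x} :=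
      fun e => ⟨h ⟨e.1.1, e.2⟩, (ht _).trans e.1.2⟩
    have h'inj : Function.Injective h' := by
      intro a b hab
      have := hinj (congrArg Subtype.val hab)
      exact Subtype.ext (Subtype.ext (Subtype.mk.inj this))
    refine ⟨(Equiv.ofInjective h' h'inj).extendSubtype (p := q) (q := (· ∈ Set.range h')),
      fun e hx => ?_⟩
    have := (Equiv.ofInjective h' h'inj).extendSubtype_apply_of_mem
      (p := q) (q := (· ∈ Set.range h')) ⟨e, hx⟩ e.2
    rw [this]
    rfl
  choose τ hτ using key
  have ht' : ∀ e, t (τ (t e) ⟨e, rfl⟩) = t e := fun e => (τ (t e) ⟨e, rfl⟩).2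
  have hτinj : Function.Injective fun e => (τ (t e) ⟨e, rfl⟩ : E) := by
    intro a b hab
    have hab' : t a = t b := by
      rw [← ht' a, ← ht' b]; exact congrArg t hab
    have : ∀ x y (hx : t a = x) (hy : t b = y), x = y →
        (τ x ⟨a, hx⟩ : E) = τ y ⟨b, hy⟩ → a = b := by
      rintro x y hx hy rfl h
      exact congrArg Subtype.val ((τ x).injective (Subtype.ext h))
    exact this _ _ rfl rfl hab' hab
  exact ⟨Equiv.ofBijective _ (Finite.injective_iff_bijective.1 hτinj), ht', fun e => hτ _ e rfl⟩

/-- The proportion of the edges with the same trace on `X` as `e` which contain `v`. -/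
noncomputable def traceRatio {V E : Type*} [DecidableEq V] [Fintype E] (s : E → Finset V)
    (X : Finset V) (v : V) (e : E) : ℚ :=
  (#{e' | s e' ∩ X = s e ∩ X ∧ v ∈ s e'} : ℚ) / #{e' | s e' ∩ X = s e ∩ X}

/-- Edges in the same class have disjoint traces on `X`. -/
def TraceDisjoint {V E J : Type*} [DecidableEq V] (s : E → Finset V) (X : Finset V)
    (c : E → J) : Prop :=
  ∀ e e', e ≠ e' → c e = c e' → Disjoint (s e ∩ X) (s e' ∩ X)

theorem TraceDisjoint.exists_perm {V E J : Type*} [DecidableEq V] [Fintype E] [Fintype J]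
    [DecidableEq J] {s : E → Finset V} {X : Finset V} {c : E → J} (hc : TraceDisjoint s X c)
    (v : V) (hload : ∀ j, ∑ e with c e = j, traceRatio s X v e ≤ 1) :
    ∃ σ : Equiv.Perm E, (∀ e, s (σ e) ∩ X = s e ∩ X) ∧ TraceDisjoint s (insert v X) (c ∘ σ) ∧
      ∀ j, ∑ e with c e = j, traceRatio s X v e = 1 → ∃ e, v ∈ s e ∧ c (σ e) = j := by
  classical
  let w : {e // v ∈ s e} → J → ℚ := fun a j =>
    (#{e | c e = j ∧ s e ∩ X = s a ∩ X} : ℚ) / #{e | s e ∩ X = s a ∩ X}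
  have hA : ∀ a, ∑ j, w a j = 1 := by
    intro a
    simp only [w]
    rw [← Finset.sum_div, div_eq_one_iff_eq]
    · rw [Finset.card_eq_sum_card_fiberwise (f := c) (t := Finset.univ) (by simp)]
      push_cast
      refine Finset.sum_congr rfl fun j _ => ?_
      rw [Finset.filter_filter]
      simp only [and_comm]
    · have : a.1 ∈ ({e | s e ∩ X = s a ∩ X} : Finset E) := by simp
      exact_mod_cast (Finset.card_pos.2 ⟨_, this⟩).ne'
  have hJ : ∀ j, ∑ a, w a j = ∑ e with c e = j, traceRatio s X v e := by
    intro j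
    have hw : ∀ a, w a j = ∑ e with c e = j,
        if s a ∩ X = s e ∩ X then ((#{e' | s e' ∩ X = s e ∩ X} : ℚ))⁻¹ else 0 := by
      intro a
      rw [← Finset.sum_filter, Finset.filter_filter]
      simp only [w]
      rw [Finset.sum_congr rfl (g := fun _ => ((#{e' | s e' ∩ X = s a ∩ X} : ℚ))⁻¹)]
      · simp only [Finset.sum_const, nsmul_eq_mul, div_eq_mul_inv, eq_comm]
      · intro e he
        simp only [Finset.mem_filter] at he
        rw [he.2.2]
    simp only [hw]
    rw [Finset.sum_comm]
    refine Finset.sum_congr rfl fun e _ => ?_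
    rw [← Finset.sum_filter, Finset.sum_const, nsmul_eq_mul, traceRatio, div_eq_mul_inv]
    congr 2
    refine Finset.card_bij (fun a _ => a.1) ?_ ?_ ?_
    · intro a ha; simpa [a.2] using ha
    · intro a _ b _ h; exact Subtype.ext h
    · intro b hb
      simp only [Finset.mem_filter, Finset.mem_univ, true_and] at hb
      exact ⟨⟨b, hb.2⟩, by simpa using hb.1, rfl⟩
  obtain ⟨g, hg, hgw, hgs⟩ := exists_injective_of_weights w (fun a j => by positivity) hA
    fun j => (hJ j).trans_le (hload j)
  have hex : ∀ a, ∃ e, c e = g a ∧ s e ∩ X = s a ∩ X := by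
    intro a
    by_contra! hcon
    refine hgw a ?_
    have : ({e | c e = g a ∧ s e ∩ X = s a ∩ X} : Finset E) = ∅ := by
      ext e; simpa using hcon e
    simp [w, this]
  choose h hhc hhs using hex
  obtain ⟨σ, hσ, hσh⟩ := exists_perm_extending (fun e => s e ∩ X) (fun e => v ∈ s e) h
    (fun a b hab => hg (by rw [← hhc, ← hhc, hab])) hhs
  refine ⟨σ, hσ, ?_, ?_⟩
  · intro e e' hne hce
    have h1 := hc (σ e) (σ e') (σ.injective.ne hne) hce
    rw [hσ, hσ] at h1
    have h2 : ¬ (v ∈ s e ∧ v ∈ s e') := by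
      rintro ⟨h, h'⟩
      refine hne (congrArg Subtype.val (hg (a₁ := ⟨e, h⟩) (a₂ := ⟨e', h'⟩) ?_))
      rw [← hhc, ← hhc, ← hσh, ← hσh]
      exact hce
    rw [Finset.disjoint_left] at h1 ⊢
    intro x hx hx'
    simp only [Finset.mem_inter, Finset.mem_insert] at hx hx' h1
    rcases hx.2 with rfl | hxX
    · exact h2 ⟨hx.1, hx'.1⟩
    · exact h1 ⟨hx.1, hxX⟩ ⟨hx'.1, hxX⟩
  · intro j hj
    obtain ⟨a, ha⟩ := hgs j ((hJ j).trans hj)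
    exact ⟨a, a.2, by rw [hσh, hhc, ha]⟩

theorem card_filter_inter_eq {V : Type*} [Fintype V] [DecidableEq V] {r : ℕ} {X S : Finset V}
    (hS : S ⊆ X) (hr : #S ≤ r) :
    #{e ∈ Finset.powersetCard r (Finset.univ : Finset V) | e ∩ X = S} =
      (Fintype.card V - #X).choose (r - #S) := by
  rw [← Finset.card_compl, ← Finset.card_powersetCard]
  refine Finset.card_bij' (fun e _ => e \ X) (fun T _ => S ∪ T) ?_ ?_ ?_ ?_
  · intro e he
    simp only [Finset.mem_filter, Finset.mem_powersetCard] at he ⊢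
    have := Finset.card_sdiff_add_card_inter e X
    rw [he.2] at this
    refine ⟨fun x hx => ?_, by omega⟩
    simpa using (Finset.mem_sdiff.1 hx).2
  · intro T hT
    simp only [Finset.mem_filter, Finset.mem_powersetCard] at hT ⊢
    have hd : Disjoint S T :=
      (disjoint_compl_right (a := X)).mono hS hT.1
    have hTX : Disjoint T X := (disjoint_compl_left (a := X)).mono_left hT.1
    refine ⟨⟨Finset.subset_univ _, ?_⟩, ?_⟩
    · rw [Finset.card_union_of_disjoint hd]; omega
    · rw [Finset.union_inter_distrib_right, Finset.inter_eq_left.2 hS,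
        Finset.disjoint_iff_inter_eq_empty.1 hTX, Finset.union_empty]
  · intro e he
    simp only [Finset.mem_filter] at he
    simp only [← he.2]
    rw [Finset.union_comm, Finset.sdiff_union_inter]
  · intro T hT
    simp only [Finset.mem_powersetCard] at hT
    have hTX : Disjoint T X := (disjoint_compl_left (a := X)).mono_left hT.1
    simp only [Finset.union_sdiff_distrib, Finset.sdiff_eq_empty_iff_subset.2 hS,
      Finset.sdiff_eq_self_of_disjoint hTX, Finset.empty_union]

theorem inter_eq_and_mem_iff {V : Type*} [DecidableEq V] {X S e : Finset V} {v : V}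
    (hv : v ∉ X) (hS : S ⊆ X) :
    e ∩ X = S ∧ v ∈ e ↔ e ∩ insert v X = insert v S := by
  constructor
  · rintro ⟨rfl, h⟩
    rw [Finset.inter_insert_of_mem h]
  · intro h
    have hve : v ∈ e := by
      have : v ∈ e ∩ insert v X := h ▸ Finset.mem_insert_self v S
      exact (Finset.mem_inter.1 this).1
    refine ⟨?_, hve⟩
    rw [Finset.inter_insert_of_mem hve] at h
    have := congrArg (Finset.erase · v) h
    have hvS : v ∉ S := fun h => hv (hS h)
    simpa [Finset.erase_insert hvS, hv] using this

theorem card_filter_subtype {α : Type*} (G : Finset α) (p : α → Prop) [DecidablePred p] :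
    #{e : {e // e ∈ G} | p e} = #{e ∈ G | p e} := by
  classical
  rw [← Finset.card_map (Function.Embedding.subtype (· ∈ G))]
  congr 1
  ext e
  simp [and_comm]

theorem choose_add_le_choose {k ℓ a N : ℕ} (ha : 1 ≤ a) (hk : 1 ≤ k) (hN : (k + ℓ) * a ≤ N) :
    k * (N - 1).choose (a - 1) + ℓ ≤ N.choose a := by
  obtain ⟨a, rfl⟩ := Nat.exists_eq_add_of_le' ha
  have hN1 : a + 1 ≤ N := le_trans (Nat.le_mul_of_pos_left _ (by omega)) hN
  obtain ⟨N, rfl⟩ := Nat.exists_eq_add_of_le' (le_trans (by omega : 1 ≤ a + 1) hN1)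
  simp only [Nat.add_sub_cancel]
  have h1 : 0 < N.choose a := Nat.choose_pos (by omega)
  have h2 := Nat.add_one_mul_choose_eq N a
  have h3 : ((k + ℓ) * N.choose a) * (a + 1) ≤ (N + 1).choose (a + 1) * (a + 1) := by
    rw [← h2]
    calc _ = (k + ℓ) * (a + 1) * N.choose a := by ring
      _ ≤ _ := Nat.mul_le_mul_right _ hN
  have h4 := Nat.le_of_mul_le_mul_right h3 (by omega)
  nlinarith

section UniformHypergraph

variable {V : Type*} [Fintype V] [DecidableEq V] {r : ℕ} {G : Finset (Finset V)}

theorem traceRatio_eq_zero (hG : G ⊆ Finset.powersetCard r Finset.univ) {X : Finset V} {v : V}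
    (hv : v ∉ X) {e : {e // e ∈ G}} (he : r ≤ #(e.1 ∩ X)) :
    traceRatio (Subtype.val : {e // e ∈ G} → Finset V) X v e = 0 := by
  have hcard : ∀ e ∈ G, #e = r := fun e he => (Finset.mem_powersetCard.1 (hG he)).2
  have : ({e' | e'.1 ∩ X = e.1 ∩ X ∧ v ∈ e'.1} : Finset {e // e ∈ G}) = ∅ := by
    refine Finset.filter_eq_empty_iff.2 ?_
    rintro e' - ⟨h, hve⟩
    have : e'.1 ∩ X = e'.1 :=
      Finset.eq_of_subset_of_card_le Finset.inter_subset_left (by rw [h, hcard _ e'.2]; exact he)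
    exact hv (Finset.mem_inter.1 (this ▸ hve)).2
  rw [traceRatio, this]
  simp

theorem traceRatio_le (hG : G ⊆ Finset.powersetCard r Finset.univ) {k ℓ : ℕ} (hk : 1 ≤ k)
    (hℓ : #(Finset.powersetCard r Finset.univ \ G) ≤ ℓ) {X : Finset V} {v : V} (hv : v ∉ X)
    (hX : (k + ℓ) * r + #X ≤ Fintype.card V) (e : {e // e ∈ G}) :
    traceRatio (Subtype.val : {e // e ∈ G} → Finset V) X v e ≤ 1 / k := by
  rcases le_or_gt r #(e.1 ∩ X) with he | he
  · rw [traceRatio_eq_zero hG hv he]; positivity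
  have hS : e.1 ∩ X ⊆ X := Finset.inter_subset_right
  have hvS : v ∉ e.1 ∩ X := fun h => hv (hS h)
  have hnum : #{e' : {e // e ∈ G} | e'.1 ∩ X = e.1 ∩ X ∧ v ∈ e'.1} ≤
      (Fintype.card V - #X - 1).choose (r - #(e.1 ∩ X) - 1) := by
    have h := card_filter_inter_eq (r := r) (Finset.insert_subset_insert v hS)
      (by rw [Finset.card_insert_of_notMem hvS]; exact he)
    rw [Finset.card_insert_of_notMem hvS, Finset.card_insert_of_notMem hv, ← Nat.sub_sub,
      ← Nat.sub_sub] at h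
    rw [← h, card_filter_subtype G fun e' => e' ∩ X = e.1 ∩ X ∧ v ∈ e']
    simp only [inter_eq_and_mem_iff hv hS]
    exact Finset.card_le_card (Finset.filter_subset_filter _ hG)
  have hden : (Fintype.card V - #X).choose (r - #(e.1 ∩ X)) ≤
      #{e' : {e // e ∈ G} | e'.1 ∩ X = e.1 ∩ X} + ℓ := by
    rw [← card_filter_inter_eq hS he.le, card_filter_subtype G fun e' => e' ∩ X = e.1 ∩ X]
    refine le_trans (Finset.card_le_card (t := {e' ∈ G | e' ∩ X = e.1 ∩ X} ∪
      (Finset.powersetCard r Finset.univ \ G)) ?_)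
      ((Finset.card_union_le _ _).trans (Nat.add_le_add_left hℓ _))
    intro x hx
    by_cases hxG : x ∈ G <;> simp_all
  have hchoose := choose_add_le_choose (k := k) (ℓ := ℓ) (a := r - #(e.1 ∩ X))
    (N := Fintype.card V - #X) (by omega) hk
    (le_trans (Nat.mul_le_mul_left _ (Nat.sub_le _ _)) (Nat.le_sub_of_add_le hX))
  have hmain : k * #{e' : {e // e ∈ G} | e'.1 ∩ X = e.1 ∩ X ∧ v ∈ e'.1} ≤
      #{e' : {e // e ∈ G} | e'.1 ∩ X = e.1 ∩ X} := by
    have := Nat.mul_le_mul_left k hnum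
    omega
  have hpos : 0 < #{e' : {e // e ∈ G} | e'.1 ∩ X = e.1 ∩ X} :=
    Finset.card_pos.2 ⟨e, by simp⟩
  rw [traceRatio, div_le_div_iff₀ (by exact_mod_cast hpos) (by exact_mod_cast hk), mul_comm, one_mul]
  exact_mod_cast hmain

theorem traceRatio_eq (hG : G ⊆ Finset.powersetCard r Finset.univ) {X : Finset V} {v : V}
    (hv : v ∉ X) (hX : (Finset.powersetCard r Finset.univ \ G).biUnion id ⊆ X)
    (e : {e // e ∈ G}) :
    traceRatio (Subtype.val : {e // e ∈ G} → Finset V) X v e =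
      (#(e.1 \ X) : ℚ) / (Fintype.card V - #X : ℕ) := by
  have hcard := (Finset.mem_powersetCard.1 (hG e.2)).2
  have hsplit := Finset.card_sdiff_add_card_inter e.1 X
  rcases le_or_gt r #(e.1 ∩ X) with he | he
  · rw [traceRatio_eq_zero hG hv he, show #(e.1 \ X) = 0 by omega]; simp
  have hS : e.1 ∩ X ⊆ X := Finset.inter_subset_right
  have hvS : v ∉ e.1 ∩ X := fun h => hv (hS h)
  have hfilter : ({e' ∈ Finset.powersetCard r Finset.univ | e' ∩ X = e.1 ∩ X} : Finset _) =
      {e' ∈ G | e' ∩ X = e.1 ∩ X} := by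
    refine Finset.Subset.antisymm (fun x hx => ?_) (Finset.filter_subset_filter _ hG)
    simp only [Finset.mem_filter] at hx ⊢
    refine ⟨?_, hx.2⟩
    by_contra hxG
    have hxX : x ⊆ X :=
      (Finset.subset_biUnion_of_mem id (Finset.mem_sdiff.2 ⟨hx.1, hxG⟩)).trans hX
    rw [Finset.inter_eq_left.2 hxX] at hx
    rw [← hx.2, (Finset.mem_powersetCard.1 hx.1).2] at he
    exact lt_irrefl _ he
  have hnum : #{e' : {e // e ∈ G} | e'.1 ∩ X = e.1 ∩ X ∧ v ∈ e'.1} =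
      (Fintype.card V - #X - 1).choose (r - #(e.1 ∩ X) - 1) := by
    have h := card_filter_inter_eq (r := r) (Finset.insert_subset_insert v hS)
      (by rw [Finset.card_insert_of_notMem hvS]; exact he)
    rw [Finset.card_insert_of_notMem hvS, Finset.card_insert_of_notMem hv, ← Nat.sub_sub,
      ← Nat.sub_sub] at h
    rw [← h, card_filter_subtype G fun e' => e' ∩ X = e.1 ∩ X ∧ v ∈ e', ← Finset.filter_filter,
      ← hfilter, Finset.filter_filter]
    simp only [inter_eq_and_mem_iff hv hS]
  have hden : #{e' : {e // e ∈ G} | e'.1 ∩ X = e.1 ∩ X} =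
      (Fintype.card V - #X).choose (r - #(e.1 ∩ X)) := by
    rw [← card_filter_inter_eq hS he.le, card_filter_subtype G fun e' => e' ∩ X = e.1 ∩ X,
      hfilter]
  have hpos : 0 < #{e' : {e // e ∈ G} | e'.1 ∩ X = e.1 ∩ X} :=
    Finset.card_pos.2 ⟨e, by simp⟩
  have hXlt : #X < Fintype.card V := Finset.card_lt_univ_of_notMem hv
  rw [traceRatio, div_eq_div_iff (by exact_mod_cast hpos.ne')
    (by exact_mod_cast (Nat.sub_pos_of_lt hXlt).ne'), hnum, hden]
  obtain ⟨N, hN⟩ := Nat.exists_eq_add_of_le' (Nat.sub_pos_of_lt hXlt)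
  obtain ⟨a, ha⟩ := Nat.exists_eq_add_of_le' (show 1 ≤ #(e.1 \ X) by omega)
  rw [show r - #(e.1 ∩ X) = #(e.1 \ X) by omega, ha, hN]
  have := Nat.add_one_mul_choose_eq N a
  simp only [Nat.add_sub_cancel]
  norm_cast
  linarith

/-- A colouring of the edges of an almost complete uniform hypergraph by small classes can be
permuted so that each colour class becomes a matching. -/
theorem exists_perm_disjoint {J : Type*} [Fintype J] [DecidableEq J]
    (hG : G ⊆ Finset.powersetCard r Finset.univ) {k ℓ : ℕ} (hk : 1 ≤ k)
    (hℓ : #(Finset.powersetCard r Finset.univ \ G) ≤ ℓ)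
    (hn : (k + ℓ) * r + ℓ * r ≤ Fintype.card V) (c : {e // e ∈ G} → J)
    (hc : ∀ j, #{e | c e = j} ≤ k) :
    ∃ σ : Equiv.Perm {e // e ∈ G}, ∀ e e', e ≠ e' → c (σ e) = c (σ e') →
      Disjoint e.1 e'.1 := by
  have hcard : ∀ e ∈ G, #e = r := fun e he => (Finset.mem_powersetCard.1 (hG he)).2
  have hcσ : ∀ (σ : Equiv.Perm {e // e ∈ G}) j, #{e | c (σ e) = j} ≤ k := fun σ j =>
    (Finset.card_equiv σ (by simp)).trans_le (hc j)
  have hfirst : ∀ X : Finset V, #X ≤ ℓ * r →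
      ∃ σ : Equiv.Perm {e // e ∈ G}, TraceDisjoint Subtype.val X (c ∘ σ) := by
    intro X
    induction X using Finset.induction_on with
    | empty => exact fun _ => ⟨1, fun _ _ _ _ => by simp⟩
    | insert v X hv ih =>
      intro hX
      rw [Finset.card_insert_of_notMem hv] at hX
      obtain ⟨σ, hσ⟩ := ih (by omega)
      obtain ⟨τ, -, hτ, -⟩ := hσ.exists_perm v fun j => by
        calc _ ≤ ∑ e with (c ∘ σ) e = j, (1 / k : ℚ) :=
              Finset.sum_le_sum fun e _ => traceRatio_le hG hk hℓ hv (by omega) e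
          _ ≤ 1 := by
            rw [Finset.sum_const, nsmul_eq_mul, mul_one_div]
            exact div_le_one_of_le₀ (by exact_mod_cast hcσ σ j) (by positivity)
      exact ⟨τ.trans σ, hτ⟩
  set X₀ := (Finset.powersetCard r Finset.univ \ G).biUnion id with hX₀
  have hX₀card : #X₀ ≤ ℓ * r :=
    (Finset.card_biUnion_le_card_mul _ _ r fun e he =>
      (Finset.mem_powersetCard.1 (Finset.mem_sdiff.1 he).1).2.le).trans (Nat.mul_le_mul_right r hℓ)
  have hsecond : ∀ Y : Finset V, ∃ σ : Equiv.Perm {e // e ∈ G},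
      TraceDisjoint Subtype.val (Y ∪ X₀) (c ∘ σ) ∧
      ∀ j, ∑ e with c (σ e) = j, #(e.1 \ (Y ∪ X₀)) + #(Y ∪ X₀) ≤ Fintype.card V := by
    intro Y
    induction Y using Finset.induction_on with
    | empty =>
      obtain ⟨σ, hσ⟩ := hfirst X₀ hX₀card
      refine ⟨σ, by simpa using hσ, fun j => ?_⟩
      have : ∑ e with c (σ e) = j, #(e.1 \ (∅ ∪ X₀)) ≤ k * r :=
        (Finset.sum_le_card_nsmul _ _ r fun e _ =>
          (Finset.card_le_card Finset.sdiff_subset).trans (hcard _ e.2).le).trans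
          (Nat.mul_le_mul_right r (hcσ σ j))
      rw [Finset.empty_union] at this ⊢
      nlinarith
    | insert v Y _ ih =>
      rw [Finset.insert_union]
      obtain ⟨σ, hσ, hσY⟩ := ih
      set X := Y ∪ X₀
      by_cases hv : v ∈ X
      · rw [Finset.insert_eq_of_mem hv]; exact ⟨σ, hσ, hσY⟩
      have hXlt : #X < Fintype.card V := Finset.card_lt_univ_of_notMem hv
      have hload : ∀ j, ∑ e with (c ∘ σ) e = j,
          traceRatio (Subtype.val : {e // e ∈ G} → Finset V) X v e =
          (∑ e with c (σ e) = j, #(e.1 \ X) : ℕ) / (Fintype.card V - #X : ℕ) := by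
        intro j
        simp only [traceRatio_eq hG hv (Finset.subset_union_right : X₀ ⊆ X), ← Finset.sum_div]
        push_cast
        rfl
      obtain ⟨τ, hτt, hτ, hτs⟩ := hσ.exists_perm v fun j => by
        rw [hload]
        refine div_le_one_of_le₀ ?_ (by positivity)
        exact_mod_cast Nat.le_sub_of_add_le (hσY j)
      refine ⟨τ.trans σ, hτ, fun j => ?_⟩
      have hsd : ∀ e : {e // e ∈ G}, #(e.1 \ X) = #((τ e).1 \ X) := fun e => by
        have h1 := Finset.card_sdiff_add_card_inter e.1 X
        have h2 := Finset.card_sdiff_add_card_inter (τ e).1 X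
        rw [hτt, hcard _ (τ e).2] at h2
        rw [hcard _ e.2] at h1
        omega
      have hsum : ∑ e with c (σ (τ e)) = j, #(e.1 \ X) = ∑ e with c (σ e) = j, #(e.1 \ X) := by
        exact Finset.sum_equiv τ (by simp) fun e _ => hsd e
      have hle : ∀ e : {e // e ∈ G}, #(e.1 \ insert v X) ≤ #(e.1 \ X) := fun e =>
        Finset.card_le_card (Finset.sdiff_subset_sdiff subset_rfl (Finset.subset_insert _ _))
      rw [Finset.card_insert_of_notMem hv]
      change ∑ e with c (σ (τ e)) = j, #(e.1 \ insert v X) + (#X + 1) ≤ _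
      rcases (hσY j).lt_or_eq with hlt | heq
      · have : ∑ e with c (σ (τ e)) = j, #(e.1 \ insert v X) ≤
            ∑ e with c (σ (τ e)) = j, #(e.1 \ X) := Finset.sum_le_sum fun e _ => hle e
        omega
      · obtain ⟨e, hve, hce⟩ := hτs j (by
          rw [hload, div_eq_one_iff_eq (by exact_mod_cast (Nat.sub_pos_of_lt hXlt).ne')]
          exact_mod_cast (by omega))
        have : ∑ e with c (σ (τ e)) = j, #(e.1 \ insert v X) <
            ∑ e with c (σ (τ e)) = j, #(e.1 \ X) :=
          Finset.sum_lt_sum (fun e _ => hle e) ⟨e, by simpa using hce, Finset.card_lt_card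
            ⟨Finset.sdiff_subset_sdiff subset_rfl (Finset.subset_insert _ _), fun h => by
              have := h (Finset.mem_sdiff.2 ⟨hve, hv⟩)
              simp at this⟩⟩
        omega
  obtain ⟨σ, hσ, -⟩ := hsecond Finset.univ
  refine ⟨σ, fun e e' hne h => ?_⟩
  simpa [Finset.inter_univ] using (hσ e e' hne h).mono
    (Finset.inter_subset_inter_left Finset.subset_union_left)
    (Finset.inter_subset_inter_left Finset.subset_union_left)

end UniformHypergraph

theorem card_filter_div_eq {k q j : ℕ} (hk : 1 ≤ k) (hj : j < q) :
    #{i : Fin (k * q + (k - 1)) | i.1 / k = j} = k := by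
  have h : (({i : Fin (k * q + (k - 1)) | i.1 / k = j} : Finset _).map Fin.valEmbedding) =
      Finset.Ico (k * j) (k * j + k) := by
    ext x
    have hkj : k * j + k ≤ k * q := by
      rw [← Nat.mul_succ]; exact Nat.mul_le_mul_left k hj
    simp only [Finset.mem_map, Finset.mem_filter, Finset.mem_univ, true_and,
      Fin.valEmbedding_apply, Finset.mem_Ico]
    have hdiv : x / k = j ↔ k * j ≤ x ∧ x < k * j + k := by
      rw [Nat.div_eq_iff (by omega)]
      rw [mul_comm j k]; omega
    rw [← hdiv]
    constructor
    · rintro ⟨i, hi, rfl⟩; exact hi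
    · intro hx
      have := (hdiv.1 hx).2
      exact ⟨⟨x, by omega⟩, hx, rfl⟩
  rw [← Finset.card_map, h]
  simp

theorem card_filter_div_eq_last {k q : ℕ} (hk : 1 ≤ k) :
    #{i : Fin (k * q + (k - 1)) | i.1 / k = q} = k - 1 := by
  have h : (({i : Fin (k * q + (k - 1)) | i.1 / k = q} : Finset _).map Fin.valEmbedding) =
      Finset.Ico (k * q) (k * q + (k - 1)) := by
    ext x
    simp only [Finset.mem_map, Finset.mem_filter, Finset.mem_univ, true_and,
      Fin.valEmbedding_apply, Finset.mem_Ico]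
    have hdiv : x / k = q ↔ k * q ≤ x ∧ x < k * q + k := by
      rw [Nat.div_eq_iff (by omega)]
      rw [mul_comm q k]; omega
    constructor
    · rintro ⟨i, hi, rfl⟩; exact ⟨(hdiv.1 hi).1, i.2⟩
    · intro hx
      exact ⟨⟨x, hx.2⟩, hdiv.2 ⟨hx.1, by omega⟩, rfl⟩
  rw [← Finset.card_map, h]
  simp

theorem IsMatchingDecomp.le_card {k q n : ℕ} (hk : 1 ≤ k) {G : Finset (Finset (Fin n))}
    {P : Finset (Finset (Finset (Fin n)))} (hP : IsMatchingDecomp k G P)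
    (hG : #G = k * q + (k - 1)) : q + (k - 1) ≤ #P := by
  classical
  obtain ⟨hdisj, hunion, hparts⟩ := hP
  have hsum : #G = ∑ p ∈ P, #p := by
    rw [← hunion]; exact Finset.card_biUnion hdisj
  rw [← Finset.sum_filter_add_sum_filter_not P (fun p => #p = k),
    Finset.sum_congr rfl (g := fun _ => k) (fun p hp => (Finset.mem_filter.1 hp).2),
    Finset.sum_congr (s₁ := P.filter fun p => ¬ #p = k) rfl (g := fun _ => 1)
      (fun p hp => by
        obtain ⟨hp, hpk⟩ := Finset.mem_filter.1 hp
        rcases hparts p hp with ⟨e, rfl⟩ | h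
        · simp
        · exact absurd h.1 hpk),
    Finset.sum_const, Finset.sum_const, smul_eq_mul, smul_eq_mul, mul_one, hG] at hsum
  rw [← Finset.card_filter_add_card_filter_not (s := P) (fun p => #p = k)]
  obtain ⟨k, rfl⟩ := Nat.exists_eq_add_of_le' hk
  set b := #{p ∈ P | #p = k + 1}
  simp only [Nat.add_sub_cancel] at *
  have hb : b ≤ q := by
    by_contra! h
    nlinarith [Nat.mul_le_mul_right (k + 1) (show q + 1 ≤ b from h)]
  nlinarith [Nat.mul_le_mul_left k hb]

theorem exists_isMatchingDecomp {k q n r ℓ : ℕ} (hk : 1 ≤ k) {G : Finset (Finset (Fin n))}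
    (hG : G ⊆ Finset.powersetCard r Finset.univ)
    (hℓ : #(Finset.powersetCard r Finset.univ \ G) ≤ ℓ)
    (hn : (k + ℓ) * r + ℓ * r ≤ n) (hcard : #G = k * q + (k - 1)) :
    ∃ P, IsMatchingDecomp k G P ∧ #P ≤ q + (k - 1) := by
  classical
  let ε : {e // e ∈ G} ≃ Fin (k * q + (k - 1)) := Fintype.equivFinOfCardEq (by simpa using hcard)
  let c : {e // e ∈ G} → Fin (q + 1) := fun e => ⟨(ε e).1 / k, by
    rw [Nat.div_lt_iff_lt_mul (by omega)]
    have := (ε e).2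
    nlinarith [Nat.sub_add_cancel hk]⟩
  have hc : ∀ (σ : Equiv.Perm {e // e ∈ G}) (j : Fin (q + 1)), #{e | c (σ e) = j} =
      #{i : Fin (k * q + (k - 1)) | i.1 / k = j} := fun σ j =>
    Finset.card_equiv (σ.trans ε) (by simp [c, Fin.ext_iff])
  have hck : ∀ (σ : Equiv.Perm {e // e ∈ G}) (j : Fin (q + 1)), j.1 < q →
      #{e | c (σ e) = j} = k := fun σ j hj => (hc σ j).trans (card_filter_div_eq hk hj)
  have hcl : ∀ (σ : Equiv.Perm {e // e ∈ G}) (j : Fin (q + 1)), ¬ j.1 < q →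
      #{e | c (σ e) = j} = k - 1 := fun σ j hj => by
    rw [hc σ j, show j.1 = q by omega]
    exact card_filter_div_eq_last hk
  obtain ⟨σ, hσ⟩ := exists_perm_disjoint hG hk hℓ (by simpa using hn) c fun j => by
    by_cases hj : j.1 < q
    · exact (hck 1 j hj).le
    · exact (hcl 1 j hj).le.trans (Nat.sub_le _ _)
  let part : {e // e ∈ G} → Finset (Finset (Fin n)) := fun e =>
    if (c (σ e)).1 < q then
      ({e' | c (σ e') = c (σ e)} : Finset {e // e ∈ G}).map (Function.Embedding.subtype _)
    else {e.1}
  have hmem : ∀ (e e' : {e // e ∈ G}), e'.1 ∈ part e ↔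
      if (c (σ e)).1 < q then c (σ e') = c (σ e) else e' = e := by
    intro e e'
    simp only [part]
    split_ifs
    · simp
    · exact Finset.mem_singleton.trans Subtype.ext_iff.symm
  have hpart : ∀ (e e' : {e // e ∈ G}), e'.1 ∈ part e → part e' = part e := by
    intro e e' h
    rw [hmem] at h
    split_ifs at h with hq
    · simp only [part, h]
      simp [hq]
    · rw [h]
  have hsub : ∀ e, ∀ x ∈ part e, x ∈ G := by
    intro e x hx
    simp only [part] at hx
    split_ifs at hx
    · obtain ⟨y, -, rfl⟩ := Finset.mem_map.1 hx
      exact y.2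
    · rw [Finset.mem_singleton.1 hx]; exact e.2
  have hself : ∀ e, e.1 ∈ part e := fun e => by rw [hmem]; simp
  refine ⟨Finset.univ.image part, ⟨?_, ?_, ?_⟩, ?_⟩
  · simp only [Finset.mem_image, Finset.mem_univ, true_and]
    rintro _ ⟨e, rfl⟩ _ ⟨e', rfl⟩ hne
    rw [Finset.disjoint_left]
    intro x hx hx'
    exact hne ((hpart e ⟨x, hsub e x hx⟩ hx).symm.trans (hpart e' ⟨x, hsub e x hx⟩ hx'))
  · ext x
    simp only [Finset.mem_biUnion, Finset.mem_image, Finset.mem_univ, true_and, id]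
    constructor
    · rintro ⟨_, ⟨e, rfl⟩, hx⟩; exact hsub e x hx
    · intro hx; exact ⟨_, ⟨⟨x, hx⟩, rfl⟩, hself ⟨x, hx⟩⟩
  · simp only [Finset.mem_image, Finset.mem_univ, true_and]
    rintro _ ⟨e, rfl⟩
    by_cases hq : (c (σ e)).1 < q
    · refine Or.inr ⟨?_, ?_⟩
      · simp only [part, hq, if_true, Finset.card_map]
        exact hck σ _ hq
      · intro x hx y hy hxy
        have hx' := (hmem e ⟨x, hsub e x hx⟩).1 hx
        have hy' := (hmem e ⟨y, hsub e y hy⟩).1 hy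
        rw [if_pos hq] at hx' hy'
        exact hσ ⟨x, _⟩ ⟨y, _⟩ (fun h => hxy (congrArg Subtype.val h)) (hx'.trans hy'.symm)
    · exact Or.inl ⟨e.1, by simp [part, hq]⟩
  · have hsplit : Finset.univ.image part ⊆
        (Finset.univ.image fun j : Fin q =>
          ({e' | c (σ e') = j.castSucc} : Finset {e // e ∈ G}).map
            (Function.Embedding.subtype _)) ∪
        ({e | c (σ e) = Fin.last q} : Finset {e // e ∈ G}).image fun e => {e.1} := by
      intro p hp
      obtain ⟨e, -, rfl⟩ := Finset.mem_image.1 hp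
      rw [Finset.mem_union]
      by_cases hq : (c (σ e)).1 < q
      · refine Or.inl (Finset.mem_image.2 ⟨⟨_, hq⟩, Finset.mem_univ _, ?_⟩)
        simp only [part, hq, if_true]
        rfl
      · refine Or.inr (Finset.mem_image.2 ⟨e, ?_, ?_⟩)
        · simp only [Finset.mem_filter, Finset.mem_univ, true_and, Fin.ext_iff, Fin.val_last]
          omega
        · simp [part, hq]
    refine (Finset.card_le_card hsplit).trans ((Finset.card_union_le _ _).trans
      (add_le_add (Finset.card_image_le.trans (by simp)) (Finset.card_image_le.trans ?_)))
    exact (hcl σ _ (by simp)).le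

/-- For `k ≥ 1`, `r ≥ 2`, `n ≥ kr(k+r-2) + 2r - 1`, let `ℓ` be the integer with
`0 ≤ ℓ ≤ k - 1` and `C(n,r) - ℓ ≡ k - 1 (mod k)`, and let `G` be any `r`-graph obtained
from the complete `r`-graph `K_n^r` by deleting `ℓ` edges. Then, for `H` the `r`-graph
consisting of exactly `k` pairwise disjoint edges,
`φ_H^r(G) = (C(n,r) - ℓ - (k - 1))/k + (k - 1)`. -/
theorem phiM_deleted_complete (k r n ℓ : ℕ) (hk : 1 ≤ k) (hr : 2 ≤ r)
    (hn : k * r * (k + r - 2) + 2 * r - 1 ≤ n)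
    (hℓ : ℓ ≤ k - 1) (hℓ' : (n.choose r - ℓ) % k = k - 1)
    (G : Finset (Finset (Fin n)))
    (hG : G ⊆ Finset.powersetCard r (Finset.univ : Finset (Fin n)))
    (hcard : G.card = n.choose r - ℓ) :
    phiM k G = (n.choose r - ℓ - (k - 1)) / k + (k - 1) := by
  have hL : #(Finset.powersetCard r (Finset.univ : Finset (Fin n)) \ G) ≤ ℓ := by
    rw [Finset.card_sdiff_of_subset hG, Finset.card_powersetCard, hcard, Finset.card_univ,
      Fintype.card_fin]
    omega
  have hn' : (k + ℓ) * r + ℓ * r ≤ n := by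
    obtain ⟨k, rfl⟩ := Nat.exists_eq_add_of_le' hk
    obtain ⟨r, rfl⟩ := Nat.exists_eq_add_of_le' hr
    rw [Nat.add_sub_cancel] at hℓ
    rw [show k + 1 + (r + 2) - 2 = k + 1 + r by omega] at hn
    have h1 : (k + 1 + ℓ) * (r + 2) + ℓ * (r + 2) ≤ (3 * k + 1) * (r + 2) := by
      nlinarith [Nat.mul_le_mul_right (r + 2) hℓ]
    have h2 : (3 * k + 1) * (r + 2) ≤ (k + 1) * (r + 2) * (k + 1 + r) + (r + 2) := by
      have : 3 * k + 1 ≤ (k + 1) * (k + 1 + r) + 1 := by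
        rcases k with _ | k
        · simp
        · nlinarith
      calc _ ≤ ((k + 1) * (k + 1 + r) + 1) * (r + 2) := Nat.mul_le_mul_right _ this
        _ = _ := by ring
    omega
  have hq := Nat.div_add_mod (n.choose r - ℓ) k
  rw [hℓ'] at hq
  set q := (n.choose r - ℓ) / k
  have hdiv : (n.choose r - ℓ - (k - 1)) / k = q := by
    rw [← hq, Nat.add_sub_cancel, Nat.mul_div_cancel_left _ hk]
  rw [hdiv]
  have hGq : #G = k * q + (k - 1) := by rw [hcard, hq]
  obtain ⟨P, hP, hPc⟩ := exists_isMatchingDecomp hk hG hL hn' hGq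
  refine le_antisymm (le_trans (Nat.sInf_le ⟨P, hP, rfl⟩) hPc) (le_csInf ⟨#P, P, hP, rfl⟩ ?_)
  rintro _ ⟨P', hP', rfl⟩
  exact hP'.le_card hk hGq
end
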